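/- arXiv:2105.07679 — 2 statements merged into one kernel-verified Lean document; each statement's English description precedes it below -/
import Mathlib

section
/- For every positive semidefinite four-partite matrix ρ : Matrix (a × b × c × d) (a × b × c × d) ℂ, the three-party reduced matrices satisfy r(ρ_ABC) · r(ρ_ABD) · r(ρ_ACD) ≥ r(ρ_BCD). -/
open Matrix
open scoped ComplexOrder

section
variable {a b c d : Type*} [Fintype a] [Fintype b] [Fintype c] [Fintype d]

/-- Partial trace over the fourth system `D`. -/
noncomputable def trD (ρ : Matrix (a × b × c × d) (a × b × c × d) ℂ) :
    Matrix (a × b × c) (a × b × c) ℂ :=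
  Matrix.of fun p q => ∑ l : d, ρ (p.1, p.2.1, p.2.2, l) (q.1, q.2.1, q.2.2, l)

/-- Partial trace over the third system `C`. -/
noncomputable def trC (ρ : Matrix (a × b × c × d) (a × b × c × d) ℂ) :
    Matrix (a × b × d) (a × b × d) ℂ :=
  Matrix.of fun p q => ∑ k : c, ρ (p.1, p.2.1, k, p.2.2) (q.1, q.2.1, k, q.2.2)

/-- Partial trace over the second system `B`. -/
noncomputable def trB (ρ : Matrix (a × b × c × d) (a × b × c × d) ℂ) :
    Matrix (a × c × d) (a × c × d) ℂ :=
  Matrix.of fun p q => ∑ j : b, ρ (p.1, j, p.2.1, p.2.2) (q.1, j, q.2.1, q.2.2)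

/-- Partial trace over the first system `A`. -/
noncomputable def trA (ρ : Matrix (a × b × c × d) (a × b × c × d) ℂ) :
    Matrix (b × c × d) (b × c × d) ℂ :=
  Matrix.of fun p q => ∑ i : a, ρ (i, p.1, p.2.1, p.2.2) (i, q.1, q.2.1, q.2.2)

section helpers

open Module

/-- A small perturbation of an injective map is injective. -/
lemma exists_perturb_injective {X Y : Type*} [AddCommGroup X] [Module ℂ X] [FiniteDimensional ℂ X]
    [AddCommGroup Y] [Module ℂ Y] (f g : X →ₗ[ℂ] Y) (hf : Function.Injective f) :
    ∃ t : ℂ, t ≠ 0 ∧ Function.Injective (f + t • g) := by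
  obtain ⟨π, hπ⟩ := f.exists_leftInverse_of_injective (LinearMap.ker_eq_bot.mpr hf)
  have hfin : {μ : ℂ | (Module.End.HasEigenvalue (π ∘ₗ g) μ)}.Finite :=
    Module.End.finite_hasEigenvalue (π ∘ₗ g)
  obtain ⟨μ, hμ⟩ := (hfin.union (Set.finite_singleton (0 : ℂ))).infinite_compl.nonempty
  simp only [Set.mem_compl_iff, Set.mem_union, Set.mem_ofPred_eq, Set.mem_singleton_iff,
    not_or] at hμ
  obtain ⟨hμ1, hμ0⟩ := hμ
  refine ⟨-μ⁻¹, by simpa using hμ0, ?_⟩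
  rw [← LinearMap.ker_eq_bot, LinearMap.ker_eq_bot']
  intro x hx
  by_contra hx0
  apply hμ1
  apply Module.End.hasEigenvalue_of_hasEigenvector (x := x)
  refine ⟨?_, hx0⟩
  rw [Module.End.mem_eigenspace_iff]
  have h1 : π (f x) = x := by
    have := congrArg (fun k => k x) hπ
    simpa using this
  have h2 := congrArg π hx
  simp only [LinearMap.add_apply, LinearMap.smul_apply, map_add, map_smul, h1, map_zero] at h2
  have h3 : x = μ⁻¹ • π (g x) := by
    rw [neg_smul] at h2
    exact (add_neg_eq_zero.mp h2)
  have h4 : μ • x = π (g x) := by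
    conv_lhs => rw [h3]
    rw [smul_smul, mul_inv_cancel₀ hμ0, one_smul]
  simpa using h4.symm

/-- If `f` has maximal rank on the line `f + t g`, then `g` maps `ker f` into `range f`. -/
lemma map_ker_le_range_of_max {X Y : Type*} [AddCommGroup X] [Module ℂ X] [FiniteDimensional ℂ X]
    [AddCommGroup Y] [Module ℂ Y] [FiniteDimensional ℂ Y] (f g : X →ₗ[ℂ] Y)
    (hmax : ∀ t : ℂ, finrank ℂ (LinearMap.range (f + t • g)) ≤ finrank ℂ (LinearMap.range f))
    (x : X) (hx : f x = 0) : g x ∈ LinearMap.range f := by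
  by_contra hgx
  obtain ⟨W, hW⟩ := (LinearMap.ker f).exists_isCompl
  let F : (W × ℂ) →ₗ[ℂ] Y := (f ∘ₗ W.subtype).coprod (LinearMap.toSpanSingleton ℂ Y (g x))
  let G : (W × ℂ) →ₗ[ℂ] Y := (g ∘ₗ W.subtype).coprod 0
  have hF : Function.Injective F := by
    rw [← LinearMap.ker_eq_bot, LinearMap.ker_eq_bot']
    rintro ⟨w, s⟩ h
    have h' : f w + s • g x = 0 := by simpa [F] using h
    have hs : s = 0 := by
      by_contra hs
      apply hgx
      refine ⟨-(s⁻¹ • (w : X)), ?_⟩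
      have : f w = -(s • g x) := eq_neg_of_add_eq_zero_left h'
      rw [map_neg, map_smul, this, smul_neg, neg_neg, smul_smul, inv_mul_cancel₀ hs, one_smul]
    subst hs
    have hw : (w : X) ∈ LinearMap.ker f ⊓ W := ⟨by simpa using h', w.2⟩
    rw [hW.inf_eq_bot, Submodule.mem_bot] at hw
    ext <;> simp [hw]
  obtain ⟨t, ht, hinj⟩ := exists_perturb_injective F G hF
  have hle : LinearMap.range (F + t • G) ≤ LinearMap.range (f + t • g) := by
    rintro _ ⟨⟨w, s⟩, rfl⟩
    refine ⟨w + (t⁻¹ * s) • x, ?_⟩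
    simp [F, G, hx, smul_smul, mul_inv_cancel_left₀ ht]
    abel_nf
    try simp [mul_comm, mul_left_comm, ht]
  have h1 := Submodule.finrank_mono hle
  rw [LinearMap.finrank_range_of_inj hinj, Module.finrank_prod, finrank_self] at h1
  have h2 := hmax t
  have h3 := Submodule.finrank_add_eq_of_isCompl hW
  have h4 := LinearMap.finrank_range_add_finrank_ker f
  omega

/-- If `φ` kills `Z ≤ S`, then `dim Z + dim φ(S) ≤ dim S`. -/
lemma finrank_add_map_le {V W : Type*} [AddCommGroup V] [Module ℂ V] [FiniteDimensional ℂ V]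
    [AddCommGroup W] [Module ℂ W] (φ : V →ₗ[ℂ] W) (Z S : Submodule ℂ V) (hle : Z ≤ S)
    (h0 : ∀ z ∈ Z, φ z = 0) : finrank ℂ Z + finrank ℂ (S.map φ) ≤ finrank ℂ S := by
  have h1 := LinearMap.finrank_range_add_finrank_ker (φ.domRestrict S)
  rw [LinearMap.range_domRestrict] at h1
  have h3 : Z.comap S.subtype ≤ LinearMap.ker (φ.domRestrict S) := by
    rintro ⟨v, hv⟩ hz
    exact h0 v hz
  have h4 := Submodule.finrank_mono h3
  rw [(Submodule.comapSubtypeEquivOfLe hle).finrank_eq] at h4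
  omega

section multilin

set_option linter.unusedSectionVars false

variable {E A : Type*} [AddCommGroup E] [Module ℂ E] [FiniteDimensional ℂ E]
  [AddCommGroup A] [Module ℂ A] [FiniteDimensional ℂ A]

/-- Span of the slices in the first slot. -/
noncomputable def slices {B C D : Type*} [AddCommGroup B] [Module ℂ B]
    [AddCommGroup C] [Module ℂ C] [AddCommGroup D] [Module ℂ D]
    (β : E →ₗ[ℂ] B →ₗ[ℂ] C →ₗ[ℂ] D →ₗ[ℂ] A) : Submodule ℂ (C →ₗ[ℂ] D →ₗ[ℂ] A) :=
  ⨆ e, LinearMap.range (β e)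

/-- Cyclic rotation of the arguments of a trilinear map, as a linear map. -/
noncomputable def rotL (B C D A : Type*) [AddCommGroup B] [Module ℂ B]
    [AddCommGroup C] [Module ℂ C] [AddCommGroup D] [Module ℂ D] [AddCommGroup A] [Module ℂ A] :
    (B →ₗ[ℂ] C →ₗ[ℂ] D →ₗ[ℂ] A) →ₗ[ℂ] (C →ₗ[ℂ] D →ₗ[ℂ] B →ₗ[ℂ] A) where
  toFun f := ((LinearMap.lflip : (B →ₗ[ℂ] D →ₗ[ℂ] A) ≃ₗ[ℂ] (D →ₗ[ℂ] B →ₗ[ℂ] A)) :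
    (B →ₗ[ℂ] D →ₗ[ℂ] A) →ₗ[ℂ] (D →ₗ[ℂ] B →ₗ[ℂ] A)) ∘ₗ f.flip
  map_add' f g := by ext; simp
  map_smul' f g := by ext; simp

/-- Cyclic rotation of the slots. -/
noncomputable def rot {B C D : Type*} [AddCommGroup B] [Module ℂ B]
    [AddCommGroup C] [Module ℂ C] [AddCommGroup D] [Module ℂ D]
    (β : E →ₗ[ℂ] B →ₗ[ℂ] C →ₗ[ℂ] D →ₗ[ℂ] A) : E →ₗ[ℂ] C →ₗ[ℂ] D →ₗ[ℂ] B →ₗ[ℂ] A :=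
  rotL B C D A ∘ₗ β

@[simp] lemma rot_apply {B C D : Type*} [AddCommGroup B] [Module ℂ B]
    [AddCommGroup C] [Module ℂ C] [AddCommGroup D] [Module ℂ D]
    (β : E →ₗ[ℂ] B →ₗ[ℂ] C →ₗ[ℂ] D →ₗ[ℂ] A) (e : E) (b : B) (c : C) (d : D) :
    rot β e c d b = β e b c d := rfl

/-- The vector `e ↦ β e b c d`. -/
noncomputable def gam {B C D : Type*} [AddCommGroup B] [Module ℂ B]
    [AddCommGroup C] [Module ℂ C] [AddCommGroup D] [Module ℂ D]
    (β : E →ₗ[ℂ] B →ₗ[ℂ] C →ₗ[ℂ] D →ₗ[ℂ] A) (b : B) (c : C) (d : D) : E →ₗ[ℂ] A :=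
  ((β.flip b).flip c).flip d

@[simp] lemma gam_apply {B C D : Type*} [AddCommGroup B] [Module ℂ B]
    [AddCommGroup C] [Module ℂ C] [AddCommGroup D] [Module ℂ D]
    (β : E →ₗ[ℂ] B →ₗ[ℂ] C →ₗ[ℂ] D →ₗ[ℂ] A) (b : B) (c : C) (d : D) (e : E) :
    gam β b c d e = β e b c d := rfl

/-- Span of all `e ↦ β e b c d`. -/
noncomputable def outs {B C D : Type*} [AddCommGroup B] [Module ℂ B]
    [AddCommGroup C] [Module ℂ C] [AddCommGroup D] [Module ℂ D]
    (β : E →ₗ[ℂ] B →ₗ[ℂ] C →ₗ[ℂ] D →ₗ[ℂ] A) : Submodule ℂ (E →ₗ[ℂ] A) :=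
  Submodule.span ℂ (Set.range fun p : B × C × D => gam β p.1 p.2.1 p.2.2)

/-- Restriction of the first slot. -/
noncomputable def res1 {B C D : Type*} [AddCommGroup B] [Module ℂ B]
    [AddCommGroup C] [Module ℂ C] [AddCommGroup D] [Module ℂ D]
    (β : E →ₗ[ℂ] B →ₗ[ℂ] C →ₗ[ℂ] D →ₗ[ℂ] A) (B' : Submodule ℂ B) :
    E →ₗ[ℂ] B' →ₗ[ℂ] C →ₗ[ℂ] D →ₗ[ℂ] A :=
  (LinearMap.lcomp ℂ (C →ₗ[ℂ] D →ₗ[ℂ] A) B'.subtype) ∘ₗ β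

@[simp] lemma res1_apply {B C D : Type*} [AddCommGroup B] [Module ℂ B]
    [AddCommGroup C] [Module ℂ C] [AddCommGroup D] [Module ℂ D]
    (β : E →ₗ[ℂ] B →ₗ[ℂ] C →ₗ[ℂ] D →ₗ[ℂ] A) (B' : Submodule ℂ B) (e : E) (b : B') :
    res1 β B' e b = β e b := rfl

lemma outs_rot {B C D : Type*} [AddCommGroup B] [Module ℂ B]
    [AddCommGroup C] [Module ℂ C] [AddCommGroup D] [Module ℂ D]
    (β : E →ₗ[ℂ] B →ₗ[ℂ] C →ₗ[ℂ] D →ₗ[ℂ] A) : outs (rot β) = outs β := by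
  unfold outs
  congr 1
  ext v
  constructor
  · rintro ⟨⟨c, d, b⟩, rfl⟩
    exact ⟨⟨b, c, d⟩, rfl⟩
  · rintro ⟨⟨b, c, d⟩, rfl⟩
    exact ⟨⟨c, d, b⟩, rfl⟩

/-- A map killing the slice space at `e₀` and carrying slices to slices loses rank. -/
lemma slices_drop {B C D C' D' : Type*} [AddCommGroup B] [Module ℂ B]
    [AddCommGroup C] [Module ℂ C] [AddCommGroup D] [Module ℂ D]
    [AddCommGroup C'] [Module ℂ C'] [AddCommGroup D'] [Module ℂ D']
    [FiniteDimensional ℂ C] [FiniteDimensional ℂ D]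
    [FiniteDimensional ℂ C'] [FiniteDimensional ℂ D']
    (β : E →ₗ[ℂ] B →ₗ[ℂ] C →ₗ[ℂ] D →ₗ[ℂ] A) (β' : E →ₗ[ℂ] B →ₗ[ℂ] C' →ₗ[ℂ] D' →ₗ[ℂ] A)
    (φ : (C →ₗ[ℂ] D →ₗ[ℂ] A) →ₗ[ℂ] (C' →ₗ[ℂ] D' →ₗ[ℂ] A))
    (hφ : ∀ e b, β' e b = φ (β e b)) (e₀ : E) (h0 : ∀ b, φ (β e₀ b) = 0) :
    finrank ℂ (LinearMap.range (β e₀)) + finrank ℂ (slices β') ≤ finrank ℂ (slices β) := by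
  have hle : LinearMap.range (β e₀) ≤ slices β := le_iSup (fun e => LinearMap.range (β e)) e₀
  have hS : slices β' = (slices β).map φ := by
    unfold slices
    rw [Submodule.map_iSup]
    congr 1
    ext1 e
    rw [← LinearMap.range_comp]
    congr 1
    ext1 b
    exact hφ e b
  rw [hS]
  refine finrank_add_map_le φ _ _ hle ?_
  rintro _ ⟨b, rfl⟩
  exact h0 b

/-- The branch of the induction where the first slot is restricted to `ker (β e₀)`. -/
lemma branch {B C D : Type} [AddCommGroup B] [Module ℂ B]
    [AddCommGroup C] [Module ℂ C] [AddCommGroup D] [Module ℂ D]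
    [FiniteDimensional ℂ B] [FiniteDimensional ℂ C] [FiniteDimensional ℂ D]
    (β : E →ₗ[ℂ] B →ₗ[ℂ] C →ₗ[ℂ] D →ₗ[ℂ] A) (e₀ : E)
    (hgen : ∀ e b, β e₀ b = 0 → β e b ∈ LinearMap.range (β e₀))
    (ih : finrank ℂ (outs (res1 β (LinearMap.ker (β e₀)))) ≤
      finrank ℂ (slices (res1 β (LinearMap.ker (β e₀)))) *
      finrank ℂ (slices (rot (res1 β (LinearMap.ker (β e₀))))) *
      finrank ℂ (slices (rot (rot (res1 β (LinearMap.ker (β e₀))))))) :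
    ∃ s' t' : ℕ,
      finrank ℂ (outs (res1 β (LinearMap.ker (β e₀)))) ≤
        finrank ℂ (LinearMap.range (β e₀)) * s' * t' ∧
      finrank ℂ (LinearMap.range (rot β e₀)) + s' ≤ finrank ℂ (slices (rot β)) ∧
      finrank ℂ (LinearMap.range (rot (rot β) e₀)) + t' ≤ finrank ℂ (slices (rot (rot β))) := by
  set B' := LinearMap.ker (β e₀) with hB'
  refine ⟨finrank ℂ (slices (rot (res1 β B'))), finrank ℂ (slices (rot (rot (res1 β B')))),
    ih.trans ?_, ?_, ?_⟩
  · gcongr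
    apply Submodule.finrank_mono
    unfold slices
    apply iSup_le
    rintro e _ ⟨b, rfl⟩
    exact hgen e b b.2
  · refine slices_drop (rot β) (rot (res1 β B'))
      (LinearMap.compRight ℂ (LinearMap.lcomp ℂ A B'.subtype)) ?_ e₀ ?_
    · intro e c; rfl
    · intro c
      ext d b
      have : β e₀ b = 0 := b.2
      change β e₀ b c d = 0
      simp [this]
  · refine slices_drop (rot (rot β)) (rot (rot (res1 β B')))
      (LinearMap.lcomp ℂ (C →ₗ[ℂ] A) B'.subtype) ?_ e₀ ?_
    · intro e c; rfl
    · intro d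
      ext b c
      have : β e₀ b = 0 := b.2
      change β e₀ b c d = 0
      simp [this]

/-- Existence of a generic point for three linear families at once. -/
lemma exists_generic {X₁ X₂ X₃ Y₁ Y₂ Y₃ : Type*}
    [AddCommGroup X₁] [Module ℂ X₁] [FiniteDimensional ℂ X₁]
    [AddCommGroup X₂] [Module ℂ X₂] [FiniteDimensional ℂ X₂]
    [AddCommGroup X₃] [Module ℂ X₃] [FiniteDimensional ℂ X₃]
    [AddCommGroup Y₁] [Module ℂ Y₁] [FiniteDimensional ℂ Y₁]
    [AddCommGroup Y₂] [Module ℂ Y₂] [FiniteDimensional ℂ Y₂]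
    [AddCommGroup Y₃] [Module ℂ Y₃] [FiniteDimensional ℂ Y₃]
    (f₁ : E →ₗ[ℂ] X₁ →ₗ[ℂ] Y₁) (f₂ : E →ₗ[ℂ] X₂ →ₗ[ℂ] Y₂) (f₃ : E →ₗ[ℂ] X₃ →ₗ[ℂ] Y₃) :
    ∃ e₀ : E, (∀ e x, f₁ e₀ x = 0 → f₁ e x ∈ LinearMap.range (f₁ e₀)) ∧
      (∀ e x, f₂ e₀ x = 0 → f₂ e x ∈ LinearMap.range (f₂ e₀)) ∧
      (∀ e x, f₃ e₀ x = 0 → f₃ e x ∈ LinearMap.range (f₃ e₀)) := by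
  let F : E → (X₁ × X₂ × X₃ →ₗ[ℂ] Y₁ × Y₂ × Y₃) :=
    fun e => (f₁ e).prodMap ((f₂ e).prodMap (f₃ e))
  have hbdd : BddAbove (Set.range fun e => finrank ℂ (LinearMap.range (F e))) :=
    ⟨finrank ℂ (Y₁ × Y₂ × Y₃), by rintro _ ⟨e, rfl⟩; exact Submodule.finrank_le _⟩
  obtain ⟨e₀, he₀⟩ := Nat.sSup_mem (Set.range_nonempty _) hbdd
  have hmax : ∀ e, finrank ℂ (LinearMap.range (F e)) ≤ finrank ℂ (LinearMap.range (F e₀)) := by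
    intro e
    have := le_csSup hbdd ⟨e, rfl⟩
    simp only at he₀
    rw [he₀]
    exact this
  have key : ∀ e x, F e₀ x = 0 → F e x ∈ LinearMap.range (F e₀) := by
    intro e x hx
    refine map_ker_le_range_of_max (F e₀) (F e) (fun t => ?_) x hx
    have : F e₀ + t • F e = F (e₀ + t • e) := by
      apply LinearMap.ext
      rintro ⟨x, y, z⟩
      simp [F]
    rw [this]
    exact hmax _
  refine ⟨e₀, fun e x hx => ?_, fun e x hx => ?_, fun e x hx => ?_⟩
  · obtain ⟨⟨y1, y2, y3⟩, hy⟩ := key e (x, 0, 0) (by simp [F, hx])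
    simp only [F, LinearMap.prodMap_apply, Prod.mk.injEq] at hy
    exact ⟨_, hy.1⟩
  · obtain ⟨⟨y1, y2, y3⟩, hy⟩ := key e (0, x, 0) (by simp [F, hx])
    simp only [F, LinearMap.prodMap_apply, Prod.mk.injEq] at hy
    exact ⟨_, hy.2.1⟩
  · obtain ⟨⟨y1, y2, y3⟩, hy⟩ := key e (0, 0, x) (by simp [F, hx])
    simp only [F, LinearMap.prodMap_apply, Prod.mk.injEq] at hy
    exact ⟨_, hy.2.2⟩

lemma finrank_outs_le {B C D : Type*} [AddCommGroup B] [Module ℂ B]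
    [AddCommGroup C] [Module ℂ C] [AddCommGroup D] [Module ℂ D]
    [FiniteDimensional ℂ B] [FiniteDimensional ℂ C] [FiniteDimensional ℂ D]
    (β : E →ₗ[ℂ] B →ₗ[ℂ] C →ₗ[ℂ] D →ₗ[ℂ] A) :
    finrank ℂ (outs β) ≤ finrank ℂ B * finrank ℂ C * finrank ℂ D := by
  let bB := finBasis ℂ B
  let bC := finBasis ℂ C
  let bD := finBasis ℂ D
  have hle : outs β ≤ Submodule.span ℂ (Set.range fun p : Fin (finrank ℂ B) × Fin (finrank ℂ C) ×
      Fin (finrank ℂ D) => gam β (bB p.1) (bC p.2.1) (bD p.2.2)) := by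
    unfold outs
    rw [Submodule.span_le]
    rintro _ ⟨⟨b, c, d⟩, rfl⟩
    have : gam β b c d = ∑ k, ∑ j, ∑ i, (bD.repr d k * (bC.repr c j * bB.repr b i)) •
        gam β (bB i) (bC j) (bD k) := by
      ext e
      simp only [gam_apply, LinearMap.sum_apply, LinearMap.smul_apply]
      conv_lhs => rw [← bB.sum_repr b, ← bC.sum_repr c, ← bD.sum_repr d]
      simp only [map_sum, map_smul, LinearMap.sum_apply, LinearMap.smul_apply, Finset.smul_sum,
        smul_smul]
    change gam β b c d ∈ _
    rw [this]
    refine Submodule.sum_mem _ fun k _ => Submodule.sum_mem _ fun j _ => Submodule.sum_mem _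
      fun i _ => Submodule.smul_mem _ _ (Submodule.subset_span ⟨(i, j, k), rfl⟩)
  refine (Submodule.finrank_mono hle).trans ((finrank_range_le_card _).trans ?_)
  simp [mul_assoc]

lemma gam_mem_res1 {B C D : Type*} [AddCommGroup B] [Module ℂ B]
    [AddCommGroup C] [Module ℂ C] [AddCommGroup D] [Module ℂ D]
    (β : E →ₗ[ℂ] B →ₗ[ℂ] C →ₗ[ℂ] D →ₗ[ℂ] A) (B' : Submodule ℂ B) (b : B) (hb : b ∈ B')
    (c : C) (d : D) : gam β b c d ∈ outs (res1 β B') :=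
  Submodule.subset_span ⟨(⟨b, hb⟩, c, d), rfl⟩

lemma finrank_compl_ker {X Y : Type*} [AddCommGroup X] [Module ℂ X] [FiniteDimensional ℂ X]
    [AddCommGroup Y] [Module ℂ Y] (f : X →ₗ[ℂ] Y) (W : Submodule ℂ X)
    (hW : IsCompl (LinearMap.ker f) W) : finrank ℂ W = finrank ℂ (LinearMap.range f) := by
  have h3 := Submodule.finrank_add_eq_of_isCompl hW
  have h4 := LinearMap.finrank_range_add_finrank_ker f
  omega

lemma finrank_ker_lt {X Y : Type*} [AddCommGroup X] [Module ℂ X] [FiniteDimensional ℂ X]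
    [AddCommGroup Y] [Module ℂ Y] (f : X →ₗ[ℂ] Y) (hf : f ≠ 0) :
    finrank ℂ (LinearMap.ker f) < finrank ℂ X := by
  apply Submodule.finrank_lt
  rw [Ne, LinearMap.ker_eq_top]
  exact hf

/-- The span of the `E ⊗ A` vectors is covered by four pieces. -/
lemma finrank_outs_split {B C D : Type*} [AddCommGroup B] [Module ℂ B]
    [AddCommGroup C] [Module ℂ C] [AddCommGroup D] [Module ℂ D]
    [FiniteDimensional ℂ B] [FiniteDimensional ℂ C] [FiniteDimensional ℂ D]
    (β : E →ₗ[ℂ] B →ₗ[ℂ] C →ₗ[ℂ] D →ₗ[ℂ] A) (e₀ : E) :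
    finrank ℂ (outs β) ≤
      finrank ℂ (LinearMap.range (β e₀)) * finrank ℂ (LinearMap.range (rot β e₀)) *
        finrank ℂ (LinearMap.range (rot (rot β) e₀)) +
      finrank ℂ (outs (res1 β (LinearMap.ker (β e₀)))) +
      finrank ℂ (outs (res1 (rot β) (LinearMap.ker (rot β e₀)))) +
      finrank ℂ (outs (res1 (rot (rot β)) (LinearMap.ker (rot (rot β) e₀)))) := by
  obtain ⟨B0, hB⟩ := (LinearMap.ker (β e₀)).exists_isCompl
  obtain ⟨C0, hC⟩ := (LinearMap.ker (rot β e₀)).exists_isCompl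
  obtain ⟨D0, hD⟩ := (LinearMap.ker (rot (rot β) e₀)).exists_isCompl
  let β0 := res1 (rot (res1 (rot (res1 β B0)) C0)) D0
  have h0 := finrank_outs_le β0
  rw [finrank_compl_ker _ _ hB, finrank_compl_ker _ _ hC, finrank_compl_ker _ _ hD] at h0
  set U1 := outs (res1 β (LinearMap.ker (β e₀))) with hU1
  set U2 := outs (res1 (rot β) (LinearMap.ker (rot β e₀))) with hU2
  set U3 := outs (res1 (rot (rot β)) (LinearMap.ker (rot (rot β) e₀))) with hU3
  have hle : outs β ≤ ((outs β0 ⊔ U1) ⊔ U2) ⊔ U3 := by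
    conv_lhs => unfold outs
    rw [Submodule.span_le]
    rintro _ ⟨⟨b, c, d⟩, rfl⟩
    obtain ⟨b1, hb1, b0, hb0, rfl⟩ := Submodule.mem_sup.mp (hB.sup_eq_top ▸ Submodule.mem_top :
      b ∈ LinearMap.ker (β e₀) ⊔ B0)
    obtain ⟨c1, hc1, c0, hc0, rfl⟩ := Submodule.mem_sup.mp (hC.sup_eq_top ▸ Submodule.mem_top :
      c ∈ LinearMap.ker (rot β e₀) ⊔ C0)
    obtain ⟨d1, hd1, d0, hd0, rfl⟩ := Submodule.mem_sup.mp (hD.sup_eq_top ▸ Submodule.mem_top :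
      d ∈ LinearMap.ker (rot (rot β) e₀) ⊔ D0)
    have heq : gam β (b1 + b0) (c1 + c0) (d1 + d0) =
        ((gam β b0 c0 d0 + gam β b1 (c1 + c0) (d1 + d0)) + gam (rot β) c1 (d1 + d0) b0) +
          gam (rot (rot β)) d1 b0 c0 := by
      ext e
      simp only [LinearMap.add_apply, gam_apply, rot_apply, map_add]
      abel
    change gam β (b1 + b0) (c1 + c0) (d1 + d0) ∈ _
    rw [heq]
    refine Submodule.add_mem_sup (Submodule.add_mem_sup (Submodule.add_mem_sup ?_ ?_) ?_) ?_
    · exact Submodule.subset_span ⟨(⟨d0, hd0⟩, ⟨b0, hb0⟩, ⟨c0, hc0⟩), rfl⟩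
    · exact gam_mem_res1 _ _ _ hb1 _ _
    · exact gam_mem_res1 _ _ _ hc1 _ _
    · exact gam_mem_res1 _ _ _ hd1 _ _
  have k1 := Submodule.finrank_mono hle
  have k2 := Submodule.finrank_add_le_finrank_add_finrank ((outs β0 ⊔ U1) ⊔ U2) U3
  have k3 := Submodule.finrank_add_le_finrank_add_finrank (outs β0 ⊔ U1) U2
  have k4 := Submodule.finrank_add_le_finrank_add_finrank (outs β0) U1
  have k5 : ∀ x y z : ℕ, z * x * y = x * y * z := fun x y z => by ring
  rw [k5] at h0
  omega

/-- Multilinear form of the rank inequality. -/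
theorem multilin_rank (n : ℕ) : ∀ (B C D : Type) [AddCommGroup B] [Module ℂ B]
    [AddCommGroup C] [Module ℂ C] [AddCommGroup D] [Module ℂ D]
    [FiniteDimensional ℂ B] [FiniteDimensional ℂ C] [FiniteDimensional ℂ D]
    (β : E →ₗ[ℂ] B →ₗ[ℂ] C →ₗ[ℂ] D →ₗ[ℂ] A), finrank ℂ B + finrank ℂ C + finrank ℂ D = n →
    finrank ℂ (outs β) ≤
      finrank ℂ (slices β) * finrank ℂ (slices (rot β)) * finrank ℂ (slices (rot (rot β))) := by
  induction n using Nat.strong_induction_on with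
  | _ n ih =>
  intro B C D _ _ _ _ _ _ _ _ _ β hn
  obtain ⟨e₀, g1, g2, g3⟩ := exists_generic β (rot β) (rot (rot β))
  by_cases hz : β e₀ = 0
  · have hall : ∀ e b, β e b = 0 := by
      intro e b
      have := g1 e b (by simp [hz])
      simpa [hz] using this
    have : outs β = ⊥ := by
      unfold outs
      rw [Submodule.span_eq_bot]
      rintro _ ⟨⟨b, c, d⟩, rfl⟩
      ext e
      simp [hall]
    rw [this]
    simp
  have hz2 : rot β e₀ ≠ 0 := by
    intro h
    apply hz
    ext b c d
    have := congrArg (fun f => f c d b) h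
    simpa using this
  have hz3 : rot (rot β) e₀ ≠ 0 := by
    intro h
    apply hz
    ext b c d
    have := congrArg (fun f => f d b c) h
    simpa using this
  have l1 := finrank_ker_lt _ hz
  have l2 := finrank_ker_lt _ hz2
  have l3 := finrank_ker_lt _ hz3
  obtain ⟨s1, t1, p1, q1, w1⟩ := branch β e₀ g1
    (ih _ (by omega) _ _ _ (res1 β (LinearMap.ker (β e₀))) rfl)
  obtain ⟨s2, t2, p2, q2, w2⟩ := branch (rot β) e₀ g2
    (ih _ (by omega) _ _ _ (res1 (rot β) (LinearMap.ker (rot β e₀))) rfl)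
  obtain ⟨s3, t3, p3, q3, w3⟩ := branch (rot (rot β)) e₀ g3
    (ih _ (by omega) _ _ _ (res1 (rot (rot β)) (LinearMap.ker (rot (rot β) e₀))) rfl)
  have hr : rot (rot (rot β)) = β := rfl
  rw [hr] at w2 q3 w3
  have hs := finrank_outs_split β e₀
  generalize finrank ℂ (LinearMap.range (β e₀)) = r at *
  generalize finrank ℂ (LinearMap.range (rot β e₀)) = s at *
  generalize finrank ℂ (LinearMap.range (rot (rot β) e₀)) = t at *
  generalize finrank ℂ (slices β) = R at *
  generalize finrank ℂ (slices (rot β)) = S at *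
  generalize finrank ℂ (slices (rot (rot β))) = T at *
  obtain ⟨r', rfl⟩ := Nat.exists_eq_add_of_le (show r ≤ R by omega)
  obtain ⟨s', rfl⟩ := Nat.exists_eq_add_of_le (show s ≤ S by omega)
  obtain ⟨t', rfl⟩ := Nat.exists_eq_add_of_le (show t ≤ T by omega)
  have m1 : r * s1 * t1 ≤ r * s' * t' := by gcongr <;> omega
  have m2 : s * s2 * t2 ≤ s * t' * r' := by gcongr <;> omega
  have m3 : t * s3 * t3 ≤ t * r' * s' := by gcongr <;> omega
  calc _ ≤ _ := hs
    _ ≤ r * s * t + r * s' * t' + s * t' * r' + t * r' * s' := by omega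
    _ ≤ r * s * t + r * s' * t' + s * t' * r' + t * r' * s' +
        (r' * s * t + r * s' * t + r * s * t' + r' * s' * t') := Nat.le_add_right _ _
    _ = _ := by ring

end multilin

section matrixpart

lemma finrank_slices_le {x j p q a m κ : Type*} [Fintype x] [Fintype j] [Fintype p] [Fintype q]
    [Fintype a] [Fintype m] [Fintype κ] [DecidableEq x] [DecidableEq j] [DecidableEq p]
    [DecidableEq q]
    (g : (x → ℂ) →ₗ[ℂ] (j → ℂ) →ₗ[ℂ] (p → ℂ) →ₗ[ℂ] (q → ℂ) →ₗ[ℂ] (a → ℂ))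
    (N : Matrix m κ ℂ) (ν : x → j → m) (σ : p → q → a → κ)
    (hg : ∀ x j k l i, g (Pi.single x 1) (Pi.single j 1) (Pi.single k 1) (Pi.single l 1) i =
      N (ν x j) (σ k l i)) :
    finrank ℂ (slices g) ≤ N.rank := by
  let Φ : (κ → ℂ) →ₗ[ℂ] ((p → ℂ) →ₗ[ℂ] (q → ℂ) →ₗ[ℂ] (a → ℂ)) :=
    { toFun := fun f => (Pi.basisFun ℂ p).constr ℂ fun k => (Pi.basisFun ℂ q).constr ℂ fun l =>
        fun i => f (σ k l i)
      map_add' := by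
        intro f g
        refine (Pi.basisFun ℂ p).ext fun k => (Pi.basisFun ℂ q).ext fun l => ?_
        simp only [LinearMap.add_apply, Basis.constr_basis]
        rfl
      map_smul' := by
        intro f g
        refine (Pi.basisFun ℂ p).ext fun k => (Pi.basisFun ℂ q).ext fun l => ?_
        simp only [LinearMap.smul_apply, Basis.constr_basis]
        rfl }
  have hΦ : ∀ x j, g (Pi.single x 1) (Pi.single j 1) = Φ (N.row (ν x j)) := by
    intro x j
    refine (Pi.basisFun ℂ p).ext fun k => (Pi.basisFun ℂ q).ext fun l => ?_
    simp only [Φ, LinearMap.coe_mk, AddHom.coe_mk, Basis.constr_basis]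
    ext i
    simp only [Pi.basisFun_apply, hg]
    rfl
  rw [Matrix.rank_eq_finrank_span_row]
  refine le_trans (Submodule.finrank_mono ?_)
    (Submodule.finrank_map_le Φ (Submodule.span ℂ (Set.range N.row)))
  unfold slices
  apply iSup_le
  rintro e _ ⟨b, rfl⟩
  rw [← (Pi.basisFun ℂ x).sum_repr e, ← (Pi.basisFun ℂ j).sum_repr b]
  simp only [map_sum, map_smul, LinearMap.sum_apply, LinearMap.smul_apply]
  refine Submodule.sum_mem _ fun j _ => Submodule.smul_mem _ _ <|
    Submodule.sum_mem _ fun x _ => Submodule.smul_mem _ _ ?_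
  rw [Pi.basisFun_apply, Pi.basisFun_apply, hΦ]
  exact Submodule.mem_map_of_mem (Submodule.subset_span ⟨_, rfl⟩)

lemma rank_le_finrank_outs {x p q l a κ : Type*} [Fintype x] [Fintype p] [Fintype q]
    [Fintype l] [Fintype a] [Fintype κ] [DecidableEq x] [DecidableEq p]
    [DecidableEq q] [DecidableEq l]
    (g : (x → ℂ) →ₗ[ℂ] (p → ℂ) →ₗ[ℂ] (q → ℂ) →ₗ[ℂ] (l → ℂ) →ₗ[ℂ] (a → ℂ))
    (N : Matrix (x × a) κ ℂ) (μ : κ → p × q × l)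
    (hg : ∀ x i k, g (Pi.single x 1) (Pi.single (μ k).1 1) (Pi.single (μ k).2.1 1)
      (Pi.single (μ k).2.2 1) i = N (x, i) k) :
    N.rank ≤ finrank ℂ (outs g) := by
  let Ψ : ((x → ℂ) →ₗ[ℂ] (a → ℂ)) →ₗ[ℂ] (x × a → ℂ) :=
    { toFun := fun f y => f (Pi.single y.1 1) y.2
      map_add' := fun _ _ => rfl
      map_smul' := fun _ _ => rfl }
  rw [Matrix.rank_eq_finrank_span_cols]
  refine le_trans (Submodule.finrank_mono ?_) (Submodule.finrank_map_le Ψ (outs g))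
  rw [Submodule.span_le]
  rintro _ ⟨k, rfl⟩
  refine ⟨gam g (Pi.single (μ k).1 1) (Pi.single (μ k).2.1 1) (Pi.single (μ k).2.2 1),
    Submodule.subset_span ⟨(_, _, _), rfl⟩, ?_⟩
  ext ⟨x, i⟩
  exact hg x i k

end matrixpart

open scoped MatrixOrder Matrix.Norms.L2Operator in
lemma exists_factor {n : Type*} [Fintype n] [DecidableEq n] (ρ : Matrix n n ℂ)
    (hρ : ρ.PosSemidef) : ∃ M : Matrix n n ℂ, ρ = Mᴴ * M := by
  obtain ⟨M, hM⟩ := CStarAlgebra.nonneg_iff_eq_star_mul_self.mp hρ.nonneg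
  exact ⟨M, hM⟩

/-- Rank of a partial trace of `Mᴴ * M`, expressed through a reshaping of `M`. -/
lemma rank_ptrace {n κ y : Type*} [Fintype n] [Fintype κ] [Fintype y]
    (M : Matrix n n ℂ) (τ : κ → y → n) (R : Matrix κ κ ℂ)
    (hR : ∀ p q, R p q = ∑ l, (Mᴴ * M) (τ p l) (τ q l)) :
    R.rank = (Matrix.of fun (w : n × y) (p : κ) => M w.1 (τ p w.2)).rank := by
  rw [← Matrix.rank_conjTranspose_mul_self (Matrix.of fun (w : n × y) (p : κ) => M w.1 (τ p w.2))]
  congr 1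
  ext p q
  rw [hR]
  simp only [Matrix.mul_apply, Matrix.conjTranspose_apply, Matrix.of_apply]
  rw [Fintype.sum_prod_type, Finset.sum_comm]

end helpers

/-- For any four-partite positive semidefinite matrix,
`r(ρ_ABC) · r(ρ_ABD) · r(ρ_ACD) ≥ r(ρ_BCD)`. -/
theorem rank_three_party_reductions_ge
    [DecidableEq a] [DecidableEq b] [DecidableEq c] [DecidableEq d]
    (ρ : Matrix (a × b × c × d) (a × b × c × d) ℂ) (hρ : ρ.PosSemidef) :
    (trD ρ).rank * (trC ρ).rank * (trB ρ).rank ≥ (trA ρ).rank := by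
  obtain ⟨M, rfl⟩ := exists_factor ρ hρ
  rw [rank_ptrace M (fun p l => (p.1, p.2.1, p.2.2, l)) (trD (Mᴴ * M)) (fun _ _ => rfl),
    rank_ptrace M (fun p k => (p.1, p.2.1, k, p.2.2)) (trC (Mᴴ * M)) (fun _ _ => rfl),
    rank_ptrace M (fun p j => (p.1, j, p.2.1, p.2.2)) (trB (Mᴴ * M)) (fun _ _ => rfl),
    rank_ptrace M (fun p i => (i, p.1, p.2.1, p.2.2)) (trA (Mᴴ * M)) (fun _ _ => rfl)]
  let eb := Fintype.equivFin b
  let ec := Fintype.equivFin c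
  let ed := Fintype.equivFin d
  let β : ((a × b × c × d) → ℂ) →ₗ[ℂ] (Fin (Fintype.card b) → ℂ) →ₗ[ℂ]
      (Fin (Fintype.card c) → ℂ) →ₗ[ℂ] (Fin (Fintype.card d) → ℂ) →ₗ[ℂ] (a → ℂ) :=
    (Pi.basisFun ℂ _).constr ℂ fun x => (Pi.basisFun ℂ _).constr ℂ fun j =>
      (Pi.basisFun ℂ _).constr ℂ fun k => (Pi.basisFun ℂ _).constr ℂ fun l =>
        fun i => M x (i, eb.symm j, ec.symm k, ed.symm l)
  have hβ : ∀ x j k l i, β (Pi.single x 1) (Pi.single j 1) (Pi.single k 1) (Pi.single l 1) i =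
      M x (i, eb.symm j, ec.symm k, ed.symm l) := by
    intro x j k l i
    simp only [β, ← Pi.basisFun_apply, Module.Basis.constr_basis]
  have hA := rank_le_finrank_outs β
    (Matrix.of fun (w : (a × b × c × d) × a) (p : b × c × d) => M w.1 (w.2, p.1, p.2.1, p.2.2))
    (fun p => (eb p.1, ec p.2.1, ed p.2.2)) (by intro x i k; simp [hβ])
  have hB := finrank_slices_le β
    (Matrix.of fun (w : (a × b × c × d) × b) (p : a × c × d) => M w.1 (p.1, w.2, p.2.1, p.2.2))
    (fun x j => (x, eb.symm j)) (fun k l i => (i, ec.symm k, ed.symm l))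
    (by intro x j k l i; simp [hβ])
  have hC := finrank_slices_le (rot β)
    (Matrix.of fun (w : (a × b × c × d) × c) (p : a × b × d) => M w.1 (p.1, p.2.1, w.2, p.2.2))
    (fun x k => (x, ec.symm k)) (fun l j i => (i, eb.symm j, ed.symm l))
    (by intro x j k l i; simp [hβ])
  have hD := finrank_slices_le (rot (rot β))
    (Matrix.of fun (w : (a × b × c × d) × d) (p : a × b × c) => M w.1 (p.1, p.2.1, p.2.2, w.2))
    (fun x l => (x, ed.symm l)) (fun j k i => (i, eb.symm j, ec.symm k))
    (by intro x j k l i; simp [hβ])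
  have key := multilin_rank _ _ _ _ β rfl
  refine ge_iff_le.mpr (hA.trans (key.trans ?_))
  refine (Nat.mul_le_mul (Nat.mul_le_mul hB hC) hD).trans (le_of_eq ?_)
  ring

end
end

section
/- For every positive semidefinite five-partite matrix ρ : Matrix (a₁ × a₂ × a₃ × a₄ × a₅) (a₁ × a₂ × a₃ × a₄ × a₅) ℂ, the four-party reduced matrices satisfy r(ρ_{A₁A₂A₃A₄}) · r(ρ_{A₁A₂A₃A₅}) · r(ρ_{A₁A₂A₄A₅}) · r(ρ_{A₁A₃A₄A₅}) ≥ r(ρ_{A₂A₃A₄A₅}). -/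
open Matrix
open scoped ComplexOrder

section
variable {a₁ a₂ a₃ a₄ a₅ : Type*}
  [Fintype a₁] [Fintype a₂] [Fintype a₃] [Fintype a₄] [Fintype a₅]

/-- Partial trace over the fifth system `A₅`. -/
noncomputable def tr5 (ρ : Matrix (a₁ × a₂ × a₃ × a₄ × a₅) (a₁ × a₂ × a₃ × a₄ × a₅) ℂ) :
    Matrix (a₁ × a₂ × a₃ × a₄) (a₁ × a₂ × a₃ × a₄) ℂ :=
  Matrix.of fun p q => ∑ k : a₅,
    ρ (p.1, p.2.1, p.2.2.1, p.2.2.2, k) (q.1, q.2.1, q.2.2.1, q.2.2.2, k)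

/-- Partial trace over the fourth system `A₄`. -/
noncomputable def tr4 (ρ : Matrix (a₁ × a₂ × a₃ × a₄ × a₅) (a₁ × a₂ × a₃ × a₄ × a₅) ℂ) :
    Matrix (a₁ × a₂ × a₃ × a₅) (a₁ × a₂ × a₃ × a₅) ℂ :=
  Matrix.of fun p q => ∑ k : a₄,
    ρ (p.1, p.2.1, p.2.2.1, k, p.2.2.2) (q.1, q.2.1, q.2.2.1, k, q.2.2.2)

/-- Partial trace over the third system `A₃`. -/
noncomputable def tr3 (ρ : Matrix (a₁ × a₂ × a₃ × a₄ × a₅) (a₁ × a₂ × a₃ × a₄ × a₅) ℂ) :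
    Matrix (a₁ × a₂ × a₄ × a₅) (a₁ × a₂ × a₄ × a₅) ℂ :=
  Matrix.of fun p q => ∑ k : a₃,
    ρ (p.1, p.2.1, k, p.2.2.1, p.2.2.2) (q.1, q.2.1, k, q.2.2.1, q.2.2.2)

/-- Partial trace over the second system `A₂`. -/
noncomputable def tr2 (ρ : Matrix (a₁ × a₂ × a₃ × a₄ × a₅) (a₁ × a₂ × a₃ × a₄ × a₅) ℂ) :
    Matrix (a₁ × a₃ × a₄ × a₅) (a₁ × a₃ × a₄ × a₅) ℂ :=
  Matrix.of fun p q => ∑ k : a₂,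
    ρ (p.1, k, p.2.1, p.2.2.1, p.2.2.2) (q.1, k, q.2.1, q.2.2.1, q.2.2.2)

/-- Partial trace over the first system `A₁`. -/
noncomputable def tr1 (ρ : Matrix (a₁ × a₂ × a₃ × a₄ × a₅) (a₁ × a₂ × a₃ × a₄ × a₅) ℂ) :
    Matrix (a₂ × a₃ × a₄ × a₅) (a₂ × a₃ × a₄ × a₅) ℂ :=
  Matrix.of fun p q => ∑ k : a₁,
    ρ (k, p.1, p.2.1, p.2.2.1, p.2.2.2) (k, q.1, q.2.1, q.2.2.1, q.2.2.2)

end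
set_option linter.unusedSectionVars false
set_option linter.unusedSimpArgs false

section flat
variable {a b c d e : Type*}

/-- flattening `ab|cd`. -/
def flR (T : a → d → Matrix b c ℂ) : Matrix (a × b) (c × d) ℂ :=
  Matrix.of fun x y => T x.1 y.2 x.2 y.1

/-- flattening `ac|bd`. -/
def flK (T : a → d → Matrix b c ℂ) : Matrix (a × c) (b × d) ℂ :=
  Matrix.of fun x y => T x.1 y.2 y.1 x.2

/-- flattening `ad|bc`. -/
def flr (T : a → d → Matrix b c ℂ) : Matrix (a × d) (b × c) ℂ :=
  Matrix.of fun x y => T x.1 x.2 y.1 y.2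

/-- joint image matrix of `N` under all slices. -/
def fln [Fintype c] (T : a → d → Matrix b c ℂ) (N : Matrix c e ℂ) : Matrix b (a × d × e) ℂ :=
  Matrix.of fun i y => (T y.1 y.2.1 * N) i y.2.2

variable [Fintype a] [Fintype b] [Fintype c] [Fintype d] [Fintype e]
variable {b' c' : Type*} [Fintype b'] [Fintype c']

theorem flK_rank_eq (T : a → d → Matrix b c ℂ) :
    (flK T).rank = (flR (fun i j => (T i j)ᵀ)).rank := rfl

theorem flR_filter (T : a → d → Matrix b c ℂ) (g : Matrix b' b ℂ) (h : Matrix c c' ℂ) :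
    (flR (fun i j => g * T i j * h)).rank ≤ (flR T).rank := by
  classical
  have : flR (fun i j => g * T i j * h)
      = Matrix.kronecker (1 : Matrix a a ℂ) g * flR T * Matrix.kronecker h (1 : Matrix d d ℂ) := by
    ext ⟨i, k⟩ ⟨l, j⟩
    simp [flR, Matrix.mul_apply, Fintype.sum_prod_type, Matrix.one_apply, Finset.sum_mul]
  rw [this]
  exact (Matrix.rank_mul_le_left _ _).trans (Matrix.rank_mul_le_right _ _)

theorem flK_filter (T : a → d → Matrix b c ℂ) (g : Matrix b' b ℂ) (h : Matrix c c' ℂ) :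
    (flK (fun i j => g * T i j * h)).rank ≤ (flK T).rank := by
  rw [flK_rank_eq, flK_rank_eq]
  have := flR_filter (fun i j => (T i j)ᵀ) hᵀ gᵀ
  simpa [Matrix.transpose_mul, Matrix.mul_assoc] using this

theorem flr_filter (T : a → d → Matrix b c ℂ) (g : Matrix b' b ℂ) (h : Matrix c c' ℂ) :
    (flr (fun i j => g * T i j * h)).rank ≤ (flr T).rank := by
  classical
  have : flr (fun i j => g * T i j * h)
      = flr T * Matrix.kronecker gᵀ h := by
    ext ⟨i, k⟩ ⟨l, j⟩
    simp only [flr, Matrix.mul_apply, Fintype.sum_prod_type, Matrix.of_apply, Finset.sum_mul,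
      Matrix.kronecker_apply, Matrix.transpose_apply]
    rw [Finset.sum_comm]
    refine Finset.sum_congr rfl fun _ _ => Finset.sum_congr rfl fun _ _ => ?_
    simp only [Matrix.kronecker, Matrix.kroneckerMap_apply, Matrix.transpose_apply]
    ring
  rw [this]
  exact Matrix.rank_mul_le_left _ _

theorem fln_left (T : a → d → Matrix b c ℂ) (N : Matrix c e ℂ) (g : Matrix b' b ℂ) :
    (fln (fun i j => g * T i j) N) = g * fln T N := by
  ext i y
  simp only [fln, Matrix.of_apply, Matrix.mul_assoc]
  rw [Matrix.mul_apply, Matrix.mul_apply]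
  rfl

theorem fln_mid (T : a → d → Matrix b c ℂ) (h : Matrix c c' ℂ) (N : Matrix c' e ℂ) :
    (fln (fun i j => T i j * h) N) = fln T (h * N) := by
  ext i y
  simp [fln, Matrix.mul_assoc]

theorem fln_right {e' : Type*} [Fintype e'] (T : a → d → Matrix b c ℂ) (N : Matrix c e ℂ)
    (h : Matrix e e' ℂ) :
    (fln T (N * h)).rank ≤ (fln T N).rank := by
  classical
  have : fln T (N * h) = fln T N *
      Matrix.kronecker (1 : Matrix a a ℂ) (Matrix.kronecker (1 : Matrix d d ℂ) h) := by
    ext i ⟨x, y, z⟩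
    simp only [fln, Matrix.of_apply, ← Matrix.mul_assoc]
    rw [Matrix.mul_apply, Matrix.mul_apply]
    simp [Fintype.sum_prod_type, Matrix.one_apply]
  rw [this]
  exact Matrix.rank_mul_le_left _ _

end flat

section blocks
variable {m₁ m₂ n₁ n₂ : Type*} [Fintype m₁] [Fintype m₂] [Fintype n₁] [Fintype n₂]

theorem rank_cols_le (A : Matrix m₁ (n₁ ⊕ n₂) ℂ) :
    A.rank ≤ (A.submatrix id Sum.inl).rank + (A.submatrix id Sum.inr).rank := by
  classical
  simp only [Matrix.rank_eq_finrank_span_cols]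
  have : Submodule.span ℂ (Set.range A.col) ≤
      Submodule.span ℂ (Set.range (A.submatrix id Sum.inl).col) ⊔
      Submodule.span ℂ (Set.range (A.submatrix id Sum.inr).col) := by
    rw [Submodule.span_le]
    rintro _ ⟨j | j, rfl⟩
    · exact Submodule.mem_sup_left (Submodule.subset_span ⟨j, rfl⟩)
    · exact Submodule.mem_sup_right (Submodule.subset_span ⟨j, rfl⟩)
  exact (Submodule.finrank_mono this).trans (Submodule.finrank_add_le_finrank_add_finrank _ _)

theorem rank_rows_le (A : Matrix (m₁ ⊕ m₂) n₁ ℂ) :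
    A.rank ≤ (A.submatrix Sum.inl id).rank + (A.submatrix Sum.inr id).rank := by
  have := rank_cols_le Aᵀ
  rw [Matrix.rank_transpose] at this
  refine this.trans (le_of_eq ?_)
  rw [← Matrix.rank_transpose (A.submatrix _ _), ← Matrix.rank_transpose (A.submatrix _ _)]
  rfl

/-- `rank A + rank D ≤ rank [[A, B], [0, D]]`. -/
theorem rank_triangular (M : Matrix (m₁ ⊕ m₂) (n₁ ⊕ n₂) ℂ)
    (h0 : ∀ i j, M (Sum.inr i) (Sum.inl j) = 0) :
    (M.submatrix Sum.inl Sum.inl).rank + (M.submatrix Sum.inr Sum.inr).rank ≤ M.rank := by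
  classical
  let W : Submodule ℂ (m₁ ⊕ m₂ → ℂ) := LinearMap.range M.mulVecLin
  let P : (m₁ ⊕ m₂ → ℂ) →ₗ[ℂ] (m₂ → ℂ) := LinearMap.funLeft ℂ ℂ Sum.inr
  let Q : (m₁ ⊕ m₂ → ℂ) →ₗ[ℂ] (m₁ → ℂ) := LinearMap.funLeft ℂ ℂ Sum.inl
  have key := LinearMap.finrank_range_add_finrank_ker (P.domRestrict W)
  have h1 : (M.submatrix Sum.inr Sum.inr).rank ≤
      Module.finrank ℂ (LinearMap.range (P.domRestrict W)) := by
    rw [Matrix.rank]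
    apply Submodule.finrank_mono
    rintro _ ⟨v, rfl⟩
    refine ⟨⟨M.mulVecLin (Sum.elim 0 v), ⟨_, rfl⟩⟩, ?_⟩
    ext i
    simp [P, LinearMap.funLeft, Matrix.mulVec, dotProduct]
  have h2 : (M.submatrix Sum.inl Sum.inl).rank ≤
      Module.finrank ℂ (LinearMap.ker (P.domRestrict W)) := by
    rw [Matrix.rank]
    let f : LinearMap.ker (P.domRestrict W) →ₗ[ℂ] (m₁ → ℂ) :=
      Q.comp (W.subtype.comp (Submodule.subtype _))
    have : LinearMap.range (M.submatrix Sum.inl Sum.inl).mulVecLin ≤ LinearMap.range f := by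
      rintro _ ⟨v, rfl⟩
      refine ⟨⟨⟨M.mulVecLin (Sum.elim v 0), ⟨_, rfl⟩⟩, ?_⟩, ?_⟩
      · rw [LinearMap.mem_ker]
        ext i
        simp [P, LinearMap.funLeft, Matrix.mulVec, dotProduct, h0]
      · ext i
        simp [f, Q, LinearMap.funLeft, Matrix.mulVec, dotProduct]
    exact (Submodule.finrank_mono this).trans (LinearMap.finrank_range_le f)
  have h3 : M.rank = Module.finrank ℂ W := rfl
  omega

/-- adapted coordinates for the column space. -/
theorem exists_adapted {m n : Type*} [Fintype m] [Fintype n] [DecidableEq m] (M : Matrix m n ℂ) :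
    ∃ s' : ℕ, M.rank + s' = Fintype.card m ∧
    ∃ (g : Matrix (Fin M.rank ⊕ Fin s') m ℂ) (g' : Matrix m (Fin M.rank ⊕ Fin s') ℂ)
      (W : Matrix n (Fin M.rank) ℂ),
      g * g' = 1 ∧ g' * g = 1 ∧ (∀ i j, (g * M) (Sum.inr i) j = 0) ∧
      g'.submatrix id Sum.inl = M * W := by
  classical
  let V : Submodule ℂ (m → ℂ) := LinearMap.range M.mulVecLin
  obtain ⟨V', hV'⟩ := Submodule.exists_isCompl V
  let b₁ : Module.Basis (Fin M.rank) ℂ V := Module.finBasis ℂ V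
  let b₂ : Module.Basis (Fin (Module.finrank ℂ V')) ℂ V' := Module.finBasis ℂ V'
  let B : Module.Basis (Fin M.rank ⊕ Fin (Module.finrank ℂ V')) ℂ (m → ℂ) :=
    (b₁.prod b₂).map (Submodule.prodEquivOfIsCompl V V' hV')
  have hBl : ∀ i, B (Sum.inl i) = (b₁ i : m → ℂ) := fun i => by simp [B]
  let S : Module.Basis m ℂ (m → ℂ) := Pi.basisFun ℂ m
  have hcard := Module.finrank_eq_card_basis B
  rw [Module.finrank_fintype_fun_eq_card] at hcard
  simp at hcard
  have hW : ∀ i : Fin M.rank, ∃ w, M *ᵥ w = (b₁ i : m → ℂ) := fun i => (b₁ i).2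
  choose w hw using hW
  refine ⟨Module.finrank ℂ V', hcard.symm, B.toMatrix S, S.toMatrix B, Matrix.of fun k i => w i k,
    B.toMatrix_mul_toMatrix_flip S, S.toMatrix_mul_toMatrix_flip B, ?_, ?_⟩
  · intro i j
    have h1 : (B.toMatrix S * M) (Sum.inr i) j = B.repr (M.col j) (Sum.inr i) := by
      have := congrFun (S.toMatrix_mulVec_repr B (M.col j)) (Sum.inr i)
      rw [← this]
      simp [Matrix.mul_apply, Matrix.mulVec, dotProduct, S]
    rw [h1]
    have hmem : M.col j ∈ V := ⟨Pi.single j 1, by simp⟩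
    have : M.col j = Submodule.prodEquivOfIsCompl V V' hV' (⟨M.col j, hmem⟩, 0) := by simp
    rw [this]
    simp only [B, Module.Basis.map_repr, LinearEquiv.trans_apply, LinearEquiv.symm_apply_apply]
    simp
  · ext k i
    simp only [Matrix.submatrix_apply, id, Module.Basis.toMatrix_apply, hBl, S, ← hw]
    simp [Matrix.mulVec, dotProduct, Matrix.mul_apply]

end blocks

/-- slope condition -/
def Slope {a b c d : Type*} [Fintype a] [Fintype c] [Fintype d]
    (T : a → d → Matrix b c ℂ) (p q : ℕ) : Prop :=
  ∀ (e : Type) [Fintype e] (N : Matrix c e ℂ), p * N.rank ≤ q * (fln T N).rank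


section induct
variable {a d : Type*} [Fintype a] [Fintype d]

theorem slope_filter {b c b' c' : Type*} [Fintype b] [Fintype c] [Fintype b'] [Fintype c']
    [DecidableEq b] [DecidableEq c']
    (T : a → d → Matrix b c ℂ) (g : Matrix b' b ℂ) (g' : Matrix b b' ℂ)
    (h : Matrix c c' ℂ) (h' : Matrix c' c ℂ) (hg : g' * g = 1) (hh : h' * h = 1) {p q : ℕ}
    (hT : Slope T p q) : Slope (fun i j => g * T i j * h) p q := by
  intro e _ N
  have h1 := hT e (h * N)
  have h2 : N.rank ≤ (h * N).rank := by
    have := Matrix.rank_mul_le_right h' (h * N)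
    rwa [← Matrix.mul_assoc, hh, Matrix.one_mul] at this
  have h3 : fln (fun i j => g * T i j * h) N = g * fln T (h * N) := by
    rw [fln_mid (fun i j => g * T i j), fln_left]
  have h4 : (fln T (h * N)).rank ≤ (g * fln T (h * N)).rank := by
    have := Matrix.rank_mul_le_right g' (g * fln T (h * N))
    rwa [← Matrix.mul_assoc, hg, Matrix.one_mul] at this
  rw [h3]
  exact (Nat.mul_le_mul_left _ h2).trans (h1.trans (Nat.mul_le_mul_left _ h4))

end induct

theorem exists_proj {m n : Type*} [Fintype m] [Fintype n] (M : Matrix m n ℂ) :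
    ∃ P : Matrix m m ℂ, P * M = M ∧ ∑ x, ∑ y, ‖P x y‖ ^ 2 = (M.rank : ℝ) := by
  classical
  have hH : (M * Mᴴ).IsHermitian := Matrix.isHermitian_mul_conjTranspose_self M
  let u : Matrix m m ℂ := hH.eigenvectorUnitary
  have hu : uᴴ * u = 1 := by
    have := Unitary.coe_star_mul_self hH.eigenvectorUnitary
    simpa [u, Matrix.star_eq_conjTranspose] using this
  let e : m → ℂ := fun i => if hH.eigenvalues i = 0 then 0 else 1
  have hspec : M * Mᴴ = u * diagonal (fun i => (hH.eigenvalues i : ℂ)) * uᴴ := by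
    have := hH.spectral_theorem
    rw [Unitary.conjStarAlgAut_apply] at this
    exact this
  let P : Matrix m m ℂ := u * diagonal e * uᴴ
  have hPM : P * (M * Mᴴ) = M * Mᴴ := by
    have : P * (M * Mᴴ) = u * (diagonal e * ((uᴴ * u) * diagonal (fun i => (hH.eigenvalues i : ℂ)))) * uᴴ := by
      conv_lhs => rw [hspec]
      simp only [P, Matrix.mul_assoc]
    rw [this, hu, Matrix.one_mul, diagonal_mul_diagonal]
    conv_rhs => rw [hspec]
    congr 3
    ext i
    simp only [e]
    split_ifs with h <;> simp [h]
  have hP2 : Pᴴ * P = P := by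
    have he : (diagonal e)ᴴ = diagonal e := by
      rw [diagonal_conjTranspose]; congr 1; ext i; simp only [e, Pi.star_apply]; split_ifs <;> simp
    have : Pᴴ * P = u * (diagonal e * ((uᴴ * u) * diagonal e)) * uᴴ := by
      simp only [P, conjTranspose_mul, conjTranspose_conjTranspose, he, Matrix.mul_assoc]
    rw [this, hu, Matrix.one_mul, diagonal_mul_diagonal]
    simp only [P]
    congr 3
    ext i
    simp only [e]
    split_ifs with h <;> simp [h]
  refine ⟨P, ?_, ?_⟩
  · have h0 : (P * M - M) * (P * M - M)ᴴ = 0 := by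
      have h1 : (P * M - M) * Mᴴ = 0 := by
        rw [Matrix.sub_mul, Matrix.mul_assoc, hPM, sub_self]
      have h2 : (P * M - M) * (P * M - M)ᴴ = (P * M - M) * Mᴴ * (Pᴴ - 1) := by
        rw [conjTranspose_sub, conjTranspose_mul, Matrix.mul_sub, Matrix.mul_sub, Matrix.mul_one,
          Matrix.mul_assoc (P * M - M)]
      rw [h2, h1, Matrix.zero_mul]
    have := (Matrix.self_mul_conjTranspose_eq_zero (A := P * M - M)).1 h0
    exact sub_eq_zero.1 this
  · have ht : Matrix.trace (Pᴴ * P) = (M.rank : ℂ) := by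
      rw [hP2]
      simp only [P]
      rw [Matrix.trace_mul_comm, ← Matrix.mul_assoc, hu, Matrix.one_mul, Matrix.trace_diagonal,
        ← Matrix.rank_self_mul_conjTranspose M, hH.rank_eq_card_non_zero_eigs]
      simp [e, Fintype.card_subtype, Finset.sum_ite]
    have h3 : Matrix.trace (Pᴴ * P) = ((∑ x, ∑ y, ‖P x y‖ ^ 2 : ℝ) : ℂ) := by
      rw [Finset.sum_comm]
      simp only [Matrix.trace, Matrix.diag_apply, Matrix.mul_apply, conjTranspose_apply]
      push_cast
      refine Finset.sum_congr rfl fun x _ => Finset.sum_congr rfl fun y _ => ?_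
      simpa using Complex.conj_mul' (P y x)
    rw [h3] at ht
    exact_mod_cast ht

theorem sum_iso {κ β : Type*} [Fintype κ] [Fintype β] [DecidableEq β] (F : κ → β → ℂ) (u : β → ℂ)
    (hF : ∀ b b', ∑ k, F k b * star (F k b') = if b = b' then 1 else 0) :
    ∑ k, ‖∑ b, u b * F k b‖ ^ 2 = ∑ b, ‖u b‖ ^ 2 := by
  have key : ((∑ k, ‖∑ b, u b * F k b‖ ^ 2 : ℝ) : ℂ) = ((∑ b, ‖u b‖ ^ 2 : ℝ) : ℂ) := by
    push_cast
    have h1 : ∀ k, (‖∑ b, u b * F k b‖ : ℂ) ^ 2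
        = ∑ b, ∑ b', u b * star (u b') * (F k b * star (F k b')) := by
      intro k
      rw [← Complex.mul_conj', map_sum, Finset.sum_mul_sum]
      refine Finset.sum_congr rfl fun b _ => Finset.sum_congr rfl fun b' _ => ?_
      simp only [map_mul, Complex.star_def]; ring
    simp_rw [h1]
    rw [Finset.sum_comm]
    refine Finset.sum_congr rfl fun b _ => ?_
    rw [Finset.sum_comm]
    simp_rw [← Finset.mul_sum, hF]
    simp [Complex.mul_conj']
  exact_mod_cast key

theorem sum_reord {A D R K : Type*} [Fintype A] [Fintype D] [Fintype R] [Fintype K]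
    {β : Type*} [AddCommMonoid β] (f : A → D → R → K → β) :
    ∑ i, ∑ j, ∑ r, ∑ k, f i j r k = ∑ i, ∑ r, ∑ p : K × D, f i p.2 r p.1 := by
  refine Finset.sum_congr rfl fun i _ => ?_
  rw [Finset.sum_comm]
  refine Finset.sum_congr rfl fun r _ => ?_
  rw [Finset.sum_comm, Fintype.sum_prod_type]

theorem sum_reord' {A D R K : Type*} [Fintype A] [Fintype D] [Fintype R] [Fintype K]
    {β : Type*} [AddCommMonoid β] (f : A → D → R → K → β) :
    ∑ i, ∑ j, ∑ r, ∑ k, f i j r k = ∑ i, ∑ k, ∑ p : R × D, f i p.2 p.1 k := by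
  rw [← sum_reord (fun i j k r => f i j r k)]
  refine Finset.sum_congr rfl fun i _ => Finset.sum_congr rfl fun j _ => ?_
  rw [Finset.sum_comm]

theorem cs_bound {a d b c : Type*} [Fintype a] [Fintype d] [Fintype b] [Fintype c]
    [DecidableEq b] [DecidableEq c]
    (S T : a → d → Matrix b c ℂ)
    (hS : ∑ i, ∑ j, (S i j)ᴴ * S i j = 1) (hT : ∑ i, ∑ j, T i j * (T i j)ᴴ = 1) :
    ‖∑ i, ∑ j, Matrix.trace ((S i j)ᴴ * T i j)‖ ^ 2 ≤ ((flR S).rank : ℝ) * (flK T).rank := by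
  obtain ⟨U, hU, hUn⟩ := exists_proj (flR S)
  obtain ⟨P, hP, hPn⟩ := exists_proj (flK T)
  let X : a → d → (a × b) → (a × c) → ℂ := fun i j r k => ∑ x, U (i, x) r * star (T k.1 j x k.2)
  let Y : a → d → (a × b) → (a × c) → ℂ := fun i j r k => ∑ y, P (i, y) k * star (S r.1 j r.2 y)
  have hX : ∑ i, ∑ j, ∑ r, ∑ k, ‖X i j r k‖ ^ 2 = ((flR S).rank : ℝ) := by
    rw [← hUn, sum_reord, Fintype.sum_prod_type]
    refine Finset.sum_congr rfl fun i _ => ?_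
    symm
    rw [Finset.sum_comm]
    symm
    refine Finset.sum_congr rfl fun r _ => ?_
    refine sum_iso (fun (k : (a × c) × d) x => star (T k.1.1 k.2 x k.1.2)) (fun x => U (i, x) r) ?_
    intro x x'
    have := congrFun (congrFun hT x') x
    simp only [Matrix.sum_apply, Matrix.mul_apply, conjTranspose_apply, Matrix.one_apply] at this
    have hc : (if x = x' then (1:ℂ) else 0) = if x' = x then 1 else 0 := by
      simp only [eq_comm]
    rw [hc, ← this]
    simp only [Fintype.sum_prod_type, star_star]
    refine Finset.sum_congr rfl fun i _ => ?_
    rw [Finset.sum_comm]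
    simp only [mul_comm]
  have hY : ∑ i, ∑ j, ∑ r, ∑ k, ‖Y i j r k‖ ^ 2 = ((flK T).rank : ℝ) := by
    rw [← hPn, sum_reord', Fintype.sum_prod_type]
    refine Finset.sum_congr rfl fun i _ => ?_
    symm
    rw [Finset.sum_comm]
    symm
    refine Finset.sum_congr rfl fun r _ => ?_
    refine sum_iso (fun (k : (a × b) × d) x => star (S k.1.1 k.2 k.1.2 x)) (fun x => P (i, x) r) ?_
    intro x x'
    have := congrFun (congrFun hS x) x'
    simp only [Matrix.sum_apply, Matrix.mul_apply, conjTranspose_apply, Matrix.one_apply] at this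
    rw [← this]
    simp only [Fintype.sum_prod_type, star_star]
    refine Finset.sum_congr rfl fun i _ => ?_
    rw [Finset.sum_comm]
  have hXY : ∑ i, ∑ j, Matrix.trace ((S i j)ᴴ * T i j)
      = ∑ i, ∑ j, ∑ r, ∑ k, star (X i j r k) * Y i j r k := by
    refine Finset.sum_congr rfl fun i _ => Finset.sum_congr rfl fun j _ => ?_
    have e1 : ∀ x y, S i j x y = ∑ r, U (i, x) r * S r.1 j r.2 y := by
      intro x y
      have := congrFun (congrFun hU (i, x)) (y, j)
      simpa [Matrix.mul_apply, flR] using this.symm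
    have e2 : ∀ x y, T i j x y = ∑ k, P (i, y) k * T k.1 j x k.2 := by
      intro x y
      have := congrFun (congrFun hP (i, y)) (x, j)
      simpa [Matrix.mul_apply, flK] using this.symm
    have e3 : Matrix.trace ((S i j)ᴴ * T i j) = ∑ y, ∑ x, ∑ r, ∑ k,
        star (U (i, x) r) * star (S r.1 j r.2 y) * (P (i, y) k * T k.1 j x k.2) := by
      simp only [Matrix.trace, Matrix.diag_apply, Matrix.mul_apply, conjTranspose_apply]
      refine Finset.sum_congr rfl fun y _ => Finset.sum_congr rfl fun x _ => ?_
      conv_lhs => rw [e1, e2]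
      rw [star_sum, Finset.sum_mul_sum]
      simp only [star_mul']
    have e4 : ∀ r k, star (X i j r k) * Y i j r k = ∑ y, ∑ x,
        star (U (i, x) r) * star (S r.1 j r.2 y) * (P (i, y) k * T k.1 j x k.2) := by
      intro r k
      simp only [X, Y]
      rw [star_sum, Finset.sum_mul_sum, Finset.sum_comm]
      refine Finset.sum_congr rfl fun y _ => Finset.sum_congr rfl fun x _ => ?_
      simp only [star_mul', star_star]
      ring
    simp_rw [e3, e4]
    have e5 : ∀ f : c → b → (a × b) → (a × c) → ℂ,
        ∑ y, ∑ x, ∑ r, ∑ k, f y x r k = ∑ r, ∑ k, ∑ y, ∑ x, f y x r k := by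
      intro f
      rw [← Fintype.sum_prod_type' (f := fun y x => ∑ r, ∑ k, f y x r k)]
      rw [Finset.sum_comm]
      refine Finset.sum_congr rfl fun r _ => ?_
      rw [Finset.sum_comm]
      refine Finset.sum_congr rfl fun k _ => ?_
      rw [Fintype.sum_prod_type]
    exact e5 _
  rw [hXY, ← hX, ← hY]
  have f1 : ∀ {β : Type} [AddCommMonoid β] (f : a → d → (a × b) → (a × c) → β),
      ∑ i, ∑ j, ∑ r, ∑ k, f i j r k =
      ∑ p : a × d × (a × b) × (a × c), f p.1 p.2.1 p.2.2.1 p.2.2.2 := by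
    intro β _ f
    rw [Fintype.sum_prod_type]
    refine Finset.sum_congr rfl fun i _ => ?_
    rw [Fintype.sum_prod_type]
    refine Finset.sum_congr rfl fun j _ => ?_
    exact (Fintype.sum_prod_type (fun p : (a × b) × (a × c) => f i j p.1 p.2)).symm
  rw [f1, f1, f1]
  refine le_trans (pow_le_pow_left₀ (norm_nonneg _) (norm_sum_le _ _) 2) ?_
  simp only [norm_mul, norm_star]
  exact Finset.sum_mul_sq_le_sq_mul_sq _ _ _
section cap
variable {a d : Type*} [Fintype a] [Fintype d]

theorem hall_slope {b c : ℕ} (W : a → d → Matrix (Fin b) (Fin c) ℂ) (hW : Slope W b c) :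
    ∃ f : Fin c × Fin b → Fin b × Fin c, Function.Bijective f ∧
      ∀ s, ∃ i j, W i j (f s).1 s.1 ≠ 0 := by
  classical
  let Z : Fin c → Finset (Fin b) := fun y => Finset.univ.filter fun x => ∃ i j, W i j x y ≠ 0
  have hall : ∀ s : Finset (Fin c × Fin b),
      s.card ≤ (s.biUnion fun p => Z p.1 ×ˢ (Finset.univ : Finset (Fin c))).card := by
    intro s
    let J := s.image Prod.fst
    have h1 : s.card ≤ b * J.card := by
      have : s ⊆ J ×ˢ (Finset.univ : Finset (Fin b)) := by
        intro p hp
        simp only [Finset.mem_product, Finset.mem_univ, and_true]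
        exact Finset.mem_image_of_mem _ hp
      refine (Finset.card_le_card this).trans ?_
      simp [mul_comm]
    have h2 : s.biUnion (fun p => Z p.1 ×ˢ (Finset.univ : Finset (Fin c)))
        = (J.biUnion Z) ×ˢ (Finset.univ : Finset (Fin c)) := by
      ext ⟨x, k⟩
      simp [J]
    rw [h2, Finset.card_product, Finset.card_univ, Fintype.card_fin]
    let N : Matrix (Fin c) (Fin c) ℂ := diagonal fun y => if y ∈ J then 1 else 0
    have h3 : N.rank = J.card := by
      simp only [N]
      rw [Matrix.rank_diagonal]
      simp
    have h4 : (fln W N).rank ≤ (J.biUnion Z).card := by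
      refine Matrix.rank_le_card_of_support_subset _ _ ?_
      rw [Function.support_subset_iff']
      intro x hx
      ext ⟨i, j, y⟩
      simp only [Matrix.row, fln, Matrix.of_apply, N, Matrix.mul_diagonal, Pi.zero_apply]
      by_cases hy : y ∈ J
      · by_cases h0 : W i j x y = 0
        · simp [h0]
        · exfalso; apply hx
          simp only [Finset.coe_biUnion, Set.mem_iUnion]
          exact ⟨y, hy, by simp only [Z, Finset.coe_filter, Finset.mem_univ, true_and]; exact ⟨i, j, h0⟩⟩
      · simp [hy]
    have h5 := hW (Fin c) N
    rw [h3] at h5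
    calc s.card ≤ b * J.card := h1
      _ ≤ c * (fln W N).rank := h5
      _ ≤ c * (J.biUnion Z).card := Nat.mul_le_mul_left _ h4
      _ = _ := mul_comm _ _
  obtain ⟨f, hf, hfZ⟩ := (Finset.all_card_le_biUnion_card_iff_exists_injective _).1 hall
  refine ⟨f, (Fintype.bijective_iff_injective_and_card f).2 ⟨hf, by simp [mul_comm]⟩, ?_⟩
  intro s
  have := hfZ s
  simp only [Finset.mem_product, Z, Finset.mem_filter, Finset.mem_univ, true_and, and_true] at this
  exact this

/-- weights -/
noncomputable def pw {b c : ℕ} (T : a → d → Matrix (Fin b) (Fin c) ℂ)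
    (w : Matrix (Fin b) (Fin b) ℂ × Matrix (Fin c) (Fin c) ℂ) (x : Fin b) (y : Fin c) : ℝ :=
  ∑ i, ∑ j, ‖((w.1)ᴴ * T i j * w.2) x y‖ ^ 2

theorem prod_bij {b c : ℕ} (f : Fin c × Fin b → Fin b × Fin c) (hf : Function.Bijective f)
    (γ : Fin b → ℝ) (η : Fin c → ℝ) :
    ∏ s, (γ (f s).1 * η s.1) = (∏ x, γ x) ^ c * (∏ y, η y) ^ b := by
  rw [Finset.prod_mul_distrib]
  congr 1
  · rw [hf.prod_comp (fun p : Fin b × Fin c => γ p.1), Fintype.prod_prod_type]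
    simp [Finset.prod_pow]
  · rw [Fintype.prod_prod_type]
    simp [Finset.prod_pow]

theorem pw_continuous {b c : ℕ} (T : a → d → Matrix (Fin b) (Fin c) ℂ) (x : Fin b) (y : Fin c) :
    Continuous fun w => pw T w x y := by
  unfold pw
  refine continuous_finsetSum _ fun i _ => continuous_finsetSum _ fun j _ => ?_
  refine (Continuous.norm ?_).pow 2
  refine Continuous.matrix_elem ?_ x y
  exact ((continuous_fst.matrix_conjTranspose).matrix_mul continuous_const).matrix_mul continuous_snd

theorem isCompact_unitary (n : ℕ) :
    IsCompact {u : Matrix (Fin n) (Fin n) ℂ | uᴴ * u = 1} := by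
  have h1 : IsCompact (Set.univ.pi fun _ : Fin n => Set.univ.pi fun _ : Fin n =>
      Metric.closedBall (0:ℂ) 1) :=
    isCompact_univ_pi fun _ => isCompact_univ_pi fun _ => isCompact_closedBall _ _
  refine h1.of_isClosed_subset ?_ ?_
  · exact isClosed_eq ((continuous_id.matrix_conjTranspose).matrix_mul continuous_id) continuous_const
  · intro u hu
    simp only [Set.mem_pi, Set.mem_univ, true_imp_iff]
    intro i j
    have : u ∈ Matrix.unitaryGroup (Fin n) ℂ := (Matrix.mem_unitaryGroup_iff').2 hu
    simpa using entry_norm_bound_of_unitary this i j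

theorem cap_unitary {b c : ℕ} (T : a → d → Matrix (Fin b) (Fin c) ℂ) (hT : Slope T b c) :
    ∃ κ : ℝ, 0 < κ ∧ ∀ w : Matrix (Fin b) (Fin b) ℂ × Matrix (Fin c) (Fin c) ℂ,
      (w.1)ᴴ * w.1 = 1 → (w.2)ᴴ * w.2 = 1 → ∀ (γ : Fin b → ℝ) (η : Fin c → ℝ),
      (∀ x, 0 ≤ γ x) → (∀ y, 0 ≤ η y) →
      κ * ((∏ x, γ x) ^ c * (∏ y, η y) ^ b) ≤ (∑ x, ∑ y, γ x * η y * pw T w x y) ^ (b * c) := by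
  have hc := (isCompact_unitary b).prod (isCompact_unitary c)
  have hpw0 : ∀ w x y, 0 ≤ pw T w x y := fun w x y =>
    Finset.sum_nonneg fun i _ => Finset.sum_nonneg fun j _ => by positivity
  have key := hc.induction_on (p := fun s => ∃ κ : ℝ, 0 < κ ∧ ∀ w ∈ s,
      ∀ (γ : Fin b → ℝ) (η : Fin c → ℝ),
      (∀ x, 0 ≤ γ x) → (∀ y, 0 ≤ η y) →
      κ * ((∏ x, γ x) ^ c * (∏ y, η y) ^ b) ≤ (∑ x, ∑ y, γ x * η y * pw T w x y) ^ (b * c))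
    ⟨1, one_pos, by simp⟩
    (fun s t hst ⟨κ, h0, h⟩ => ⟨κ, h0, fun w hw => h w (hst hw)⟩)
    (by
      rintro s t ⟨κ, h0, h⟩ ⟨κ', h0', h'⟩
      refine ⟨min κ κ', lt_min h0 h0', ?_⟩
      intro w hw γ η hγ hη
      have hp : 0 ≤ (∏ x, γ x) ^ c * (∏ y, η y) ^ b :=
        mul_nonneg (pow_nonneg (Finset.prod_nonneg fun x _ => hγ x) _)
          (pow_nonneg (Finset.prod_nonneg fun x _ => hη x) _)
      rcases hw with hw | hw
      · exact (mul_le_mul_of_nonneg_right (min_le_left _ _) hp).trans (h w hw γ η hγ hη)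
      · exact (mul_le_mul_of_nonneg_right (min_le_right _ _) hp).trans (h' w hw γ η hγ hη))
    (by
      rintro ⟨u, v⟩ ⟨hu, hv⟩
      simp only [Set.mem_ofPred_eq] at hu hv
      have hu' : u * uᴴ = 1 := mul_eq_one_comm.1 hu
      have hW : Slope (fun i j => uᴴ * T i j * v) b c := slope_filter T uᴴ u v vᴴ hu' hv hT
      obtain ⟨f, hf, hfW⟩ := hall_slope _ hW
      have hpos : ∀ s, 0 < pw T (u, v) (f s).1 s.1 := by
        intro s
        obtain ⟨i, j, hij⟩ := hfW s
        unfold pw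
        refine lt_of_lt_of_le (b := ∑ j, ‖(uᴴ * T i j * v) (f s).1 s.1‖ ^ 2)
          (lt_of_lt_of_le (b := ‖(uᴴ * T i j * v) (f s).1 s.1‖ ^ 2) ?_ ?_) ?_
        · have := norm_pos_iff.2 hij
          positivity
        · exact Finset.single_le_sum (f := fun j => ‖(uᴴ * T i j * v) (f s).1 s.1‖ ^ 2)
            (fun j _ => by positivity) (Finset.mem_univ j)
        · exact Finset.single_le_sum (f := fun i => ∑ j, ‖(uᴴ * T i j * v) (f s).1 s.1‖ ^ 2)
            (fun i _ => Finset.sum_nonneg fun j _ => by positivity) (Finset.mem_univ i)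
      refine ⟨{w | ∀ s, pw T (u, v) (f s).1 s.1 / 2 ≤ pw T w (f s).1 s.1}, ?_, ?_⟩
      · refine mem_nhdsWithin_of_mem_nhds ?_
        rw [Set.ofPred_forall]
        refine (Filter.iInter_mem).2 fun s => ?_
        have := ((pw_continuous T (f s).1 s.1).tendsto (u, v)).eventually
          (lt_mem_nhds (half_lt_self (hpos s)))
        filter_upwards [this] with w hw using hw.le
      · refine ⟨∏ s, pw T (u, v) (f s).1 s.1 / 2, Finset.prod_pos fun s _ => half_pos (hpos s), ?_⟩
        intro w hw γ η hγ hη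
        rw [← prod_bij f hf, ← Finset.prod_mul_distrib]
        have : (∑ x, ∑ y, γ x * η y * pw T w x y) ^ (b * c)
            = ∏ s : Fin c × Fin b, (∑ x, ∑ y, γ x * η y * pw T w x y) := by
          simp [mul_comm]
        rw [this]
        refine Finset.prod_le_prod ?_ ?_
        · intro s _
          exact mul_nonneg (half_pos (hpos s)).le (mul_nonneg (hγ _) (hη _))
        · intro s _
          have hnn : ∀ x y, 0 ≤ γ x * η y * pw T w x y := fun x y =>
            mul_nonneg (mul_nonneg (hγ x) (hη y)) (hpw0 _ _ _)
          calc pw T (u, v) (f s).1 s.1 / 2 * (γ (f s).1 * η s.1)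
              ≤ γ (f s).1 * η s.1 * pw T w (f s).1 s.1 := by
                rw [mul_comm]
                exact mul_le_mul_of_nonneg_left (hw s) (mul_nonneg (hγ _) (hη _))
            _ ≤ ∑ y, γ (f s).1 * η y * pw T w (f s).1 y :=
                Finset.single_le_sum (f := fun y => γ (f s).1 * η y * pw T w (f s).1 y)
                  (fun y _ => hnn _ y) (Finset.mem_univ s.1)
            _ ≤ _ := Finset.single_le_sum (f := fun x => ∑ y, γ x * η y * pw T w x y)
                  (fun x _ => Finset.sum_nonneg fun y _ => hnn x y) (Finset.mem_univ (f s).1))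
  obtain ⟨κ, h0, h⟩ := key
  exact ⟨κ, h0, fun w h1 h2 => h w ⟨h1, h2⟩⟩

/-- the quadratic form -/
noncomputable def capq {b c : ℕ} (T : a → d → Matrix (Fin b) (Fin c) ℂ)
    (g : Matrix (Fin b) (Fin b) ℂ) (h : Matrix (Fin c) (Fin c) ℂ) : ℝ :=
  ∑ i, ∑ j, ∑ x, ∑ y, ‖(g * T i j * h) x y‖ ^ 2

theorem trace_conjTranspose_mul_self' {m n : Type*} [Fintype m] [Fintype n] (A : Matrix m n ℂ) :
    Matrix.trace (Aᴴ * A) = ((∑ x, ∑ y, ‖A x y‖ ^ 2 : ℝ) : ℂ) := by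
  rw [Finset.sum_comm]
  simp only [Matrix.trace, Matrix.diag_apply, Matrix.mul_apply, conjTranspose_apply]
  push_cast
  refine Finset.sum_congr rfl fun x _ => Finset.sum_congr rfl fun y _ => ?_
  simpa using Complex.conj_mul' (A y x)

theorem exists_diag {n : ℕ} (g : Matrix (Fin n) (Fin n) ℂ) :
    ∃ (u : Matrix (Fin n) (Fin n) ℂ) (γ : Fin n → ℝ), uᴴ * u = 1 ∧ (∀ x, 0 ≤ γ x) ∧
      gᴴ * g = u * diagonal (fun x => (γ x : ℂ)) * uᴴ ∧ ‖g.det‖ ^ 2 = ∏ x, γ x := by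
  have hP : (gᴴ * g).PosSemidef := Matrix.posSemidef_conjTranspose_mul_self g
  have hH := hP.isHermitian
  refine ⟨hH.eigenvectorUnitary, hH.eigenvalues, ?_, hP.eigenvalues_nonneg, ?_, ?_⟩
  · have := Unitary.coe_star_mul_self hH.eigenvectorUnitary
    simpa [Matrix.star_eq_conjTranspose] using this
  · have := hH.spectral_theorem
    rw [Unitary.conjStarAlgAut_apply] at this
    exact this
  · have h1 := hH.det_eq_prod_eigenvalues
    rw [Matrix.det_mul, Matrix.det_conjTranspose] at h1
    have h2 : star g.det * g.det = ((‖g.det‖ ^ 2 : ℝ) : ℂ) := by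
      push_cast
      simpa using Complex.conj_mul' g.det
    rw [h2] at h1
    have h3 : ((‖g.det‖ ^ 2 : ℝ) : ℂ) = ((∏ x, hH.eigenvalues x : ℝ) : ℂ) := by
      rw [h1]; push_cast; rfl
    exact_mod_cast h3

theorem capq_diag {b c : ℕ} (T : a → d → Matrix (Fin b) (Fin c) ℂ)
    (g : Matrix (Fin b) (Fin b) ℂ) (h : Matrix (Fin c) (Fin c) ℂ)
    (u : Matrix (Fin b) (Fin b) ℂ) (v : Matrix (Fin c) (Fin c) ℂ) (γ : Fin b → ℝ) (η : Fin c → ℝ)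
    (hg : gᴴ * g = u * diagonal (fun x => (γ x : ℂ)) * uᴴ)
    (hh : h * hᴴ = v * diagonal (fun x => (η x : ℂ)) * vᴴ) :
    capq T g h = ∑ x, ∑ y, γ x * η y * pw T (u, v) x y := by
  have h1 : ∀ i j, ∑ x, ∑ y, ‖(g * T i j * h) x y‖ ^ 2
      = ∑ x, ∑ y, γ x * η y * ‖(uᴴ * T i j * v) x y‖ ^ 2 := by
    intro i j
    have e1 : Matrix.trace ((g * T i j * h)ᴴ * (g * T i j * h))
        = Matrix.trace (diagonal (fun x => (γ x : ℂ)) * (uᴴ * T i j * v)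
            * diagonal (fun x => (η x : ℂ)) * (uᴴ * T i j * v)ᴴ) := by
      calc _ = Matrix.trace (hᴴ * ((T i j)ᴴ * (gᴴ * g) * T i j * h)) := by
            simp only [conjTranspose_mul, Matrix.mul_assoc]
        _ = Matrix.trace ((T i j)ᴴ * ((gᴴ * g) * T i j * (h * hᴴ))) := by
            rw [Matrix.trace_mul_comm]; simp only [Matrix.mul_assoc]
        _ = Matrix.trace ((T i j)ᴴ * (u * (diagonal (fun x => (γ x : ℂ)) * uᴴ * T i j * (v * diagonal (fun x => (η x : ℂ)) * vᴴ)))) := by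
            rw [hg, hh]; simp only [Matrix.mul_assoc]
        _ = Matrix.trace ((diagonal (fun x => (γ x : ℂ)) * uᴴ * T i j * (v * diagonal (fun x => (η x : ℂ)) * vᴴ)) * ((T i j)ᴴ * u)) := by
            rw [← Matrix.mul_assoc, Matrix.trace_mul_comm]
        _ = _ := by
            simp only [conjTranspose_mul, conjTranspose_conjTranspose, Matrix.mul_assoc]
    rw [trace_conjTranspose_mul_self'] at e1
    have e2 : Matrix.trace (diagonal (fun x => (γ x : ℂ)) * (uᴴ * T i j * v)
            * diagonal (fun x => (η x : ℂ)) * (uᴴ * T i j * v)ᴴ)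
        = ((∑ x, ∑ y, γ x * η y * ‖(uᴴ * T i j * v) x y‖ ^ 2 : ℝ) : ℂ) := by
      generalize uᴴ * T i j * v = W
      simp only [Matrix.trace, Matrix.diag_apply, Matrix.mul_apply (N := Wᴴ), Matrix.mul_diagonal,
        Matrix.diagonal_mul, conjTranspose_apply]
      push_cast
      refine Finset.sum_congr rfl fun x _ => Finset.sum_congr rfl fun y _ => ?_
      rw [← Complex.mul_conj', Complex.star_def]
      ring
    rw [e2] at e1
    exact_mod_cast e1
  unfold capq pw
  simp_rw [h1, Finset.mul_sum]
  have e5 : ∀ f : a → d → Fin b → Fin c → ℝ,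
      ∑ i, ∑ j, ∑ x, ∑ y, f i j x y = ∑ x, ∑ y, ∑ i, ∑ j, f i j x y := by
    intro f
    rw [← Fintype.sum_prod_type' (f := fun i j => ∑ x, ∑ y, f i j x y)]
    rw [Finset.sum_comm]
    refine Finset.sum_congr rfl fun r _ => ?_
    rw [Finset.sum_comm]
    refine Finset.sum_congr rfl fun k _ => ?_
    rw [Fintype.sum_prod_type]
  exact e5 _

theorem cap_pos {b c : ℕ} (T : a → d → Matrix (Fin b) (Fin c) ℂ) (hT : Slope T b c) :
    ∃ κ : ℝ, 0 < κ ∧ ∀ g h,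
      κ * ((‖g.det‖ ^ 2) ^ c * (‖h.det‖ ^ 2) ^ b) ≤ capq T g h ^ (b * c) := by
  obtain ⟨κ, h0, hκ⟩ := cap_unitary T hT
  refine ⟨κ, h0, fun g h => ?_⟩
  obtain ⟨u, γ, hu, hγ, hg, hgd⟩ := exists_diag g
  obtain ⟨v, η, hv, hη, hh, hhd⟩ := exists_diag hᴴ
  rw [conjTranspose_conjTranspose] at hh
  rw [Matrix.det_conjTranspose, norm_star] at hhd
  rw [hgd, hhd, capq_diag T g h u v γ η hg hh]
  exact hκ (u, v) hu hv γ η hγ hη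

end cap
theorem amgm_nat {n : ℕ} (z : Fin n → ℝ) (hz : ∀ i, 0 ≤ z i) :
    (n : ℝ) ^ n * ∏ i, z i ≤ (∑ i, z i) ^ n := by
  rcases Nat.eq_zero_or_pos n with rfl | hn
  · simp
  have hn' : (0 : ℝ) < n := by exact_mod_cast hn
  have h := Real.geom_mean_le_arith_mean Finset.univ (fun _ : Fin n => (1 : ℝ)) z
    (fun _ _ => zero_le_one) (by simpa using hn') (fun i _ => hz i)
  simp only [Real.rpow_one, Finset.sum_const, Finset.card_univ, Fintype.card_fin, nsmul_eq_mul,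
    mul_one, one_mul] at h
  have hp : 0 ≤ ∏ i, z i := Finset.prod_nonneg fun i _ => hz i
  have h2 := pow_le_pow_left₀ (Real.rpow_nonneg hp _) h n
  rw [Real.rpow_inv_natCast_pow hp hn.ne', div_pow, le_div_iff₀ (by positivity)] at h2
  linarith

theorem posdef_root {n : ℕ} (A : Matrix (Fin n) (Fin n) ℂ) (hA : A.PosDef) :
    ∃ x : Matrix (Fin n) (Fin n) ℂ, (xᴴ * x) * A * (xᴴ * x) = 1 ∧
      (n : ℝ) ^ n ≤ (‖x.det‖ ^ 2) ^ 2 * (Matrix.trace A).re ^ n := by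
  have hH := hA.isHermitian
  let u : Matrix (Fin n) (Fin n) ℂ := hH.eigenvectorUnitary
  have hu : uᴴ * u = 1 := by
    have := Unitary.coe_star_mul_self hH.eigenvectorUnitary
    simpa [u, Matrix.star_eq_conjTranspose] using this
  have hu' : u * uᴴ = 1 := mul_eq_one_comm.1 hu
  obtain ⟨l, hl⟩ : ∃ l : Fin n → ℝ, l = hH.eigenvalues := ⟨_, rfl⟩
  have hlp : ∀ i, 0 < l i := by rw [hl]; exact hA.eigenvalues_pos
  have hspec : A = u * diagonal (fun i => (l i : ℂ)) * uᴴ := by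
    have := hH.spectral_theorem
    rw [Unitary.conjStarAlgAut_apply] at this
    rw [hl]
    exact this
  have htr : (Matrix.trace A).re = ∑ i, l i := by
    rw [hH.trace_eq_sum_eigenvalues, hl]
    simp
  clear hl
  let r : Fin n → ℝ := fun i => √(√(l i))⁻¹
  have hr : ∀ i, r i ^ 2 = (√(l i))⁻¹ := fun i => Real.sq_sqrt (by positivity)
  have hr4 : ∀ i, r i * r i * l i * (r i * r i) = 1 := by
    intro i
    have h1 : r i * r i = (√(l i))⁻¹ := by rw [← sq, hr]
    rw [h1]
    have h2 : √(l i) ≠ 0 := (Real.sqrt_pos.2 (hlp i)).ne'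
    have h3 : √(l i) * √(l i) = l i := Real.mul_self_sqrt (hlp i).le
    field_simp
    rw [sq, h3]
  let D : Matrix (Fin n) (Fin n) ℂ := diagonal fun i => (r i : ℂ)
  have hD : Dᴴ = D := by
    simp only [D, diagonal_conjTranspose]
    congr 1; ext i; simp
  refine ⟨D * uᴴ, ?_, ?_⟩
  · have e1 : (D * uᴴ)ᴴ * (D * uᴴ) = u * (D * D) * uᴴ := by
      rw [conjTranspose_mul, conjTranspose_conjTranspose, hD]
      simp only [Matrix.mul_assoc]
    rw [e1, hspec]
    calc _ = u * (D * D * (uᴴ * u) * diagonal (fun i => (l i : ℂ)) * (uᴴ * u) * (D * D)) * uᴴ := by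
          simp only [Matrix.mul_assoc]
      _ = u * 1 * uᴴ := by
          rw [hu, Matrix.mul_one, Matrix.mul_one]
          congr 2
          simp only [D, diagonal_mul_diagonal]
          rw [← diagonal_one]
          congr 1; ext i
          have := hr4 i
          exact_mod_cast this
      _ = 1 := by rw [Matrix.mul_one, hu']
  · have hdu : ‖u.det‖ = 1 := by
      have h := congrArg Matrix.det hu
      rw [Matrix.det_mul, Matrix.det_conjTranspose, Matrix.det_one] at h
      have h2 := congrArg norm h
      rw [norm_mul, norm_star, norm_one] at h2
      nlinarith [norm_nonneg u.det]
    have hdx : ‖(D * uᴴ).det‖ ^ 2 = ∏ i, (√(l i))⁻¹ := by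
      rw [Matrix.det_mul, Matrix.det_conjTranspose, norm_mul, norm_star, hdu, mul_one]
      simp only [D, det_diagonal, norm_prod, ← Finset.prod_pow]
      refine Finset.prod_congr rfl fun i _ => ?_
      rw [Complex.norm_real, Real.norm_eq_abs, sq_abs, hr]
    have hdx2 : (‖(D * uᴴ).det‖ ^ 2) ^ 2 * ∏ i, l i = 1 := by
      rw [hdx, ← Finset.prod_pow, ← Finset.prod_mul_distrib]
      refine Finset.prod_eq_one fun i _ => ?_
      rw [inv_pow, Real.sq_sqrt (hlp i).le, inv_mul_cancel₀ (hlp i).ne']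
    rw [htr]
    have := amgm_nat l (fun i => (hlp i).le)
    calc (n : ℝ) ^ n = (‖(D * uᴴ).det‖ ^ 2) ^ 2 * ((n : ℝ) ^ n * ∏ i, l i) := by
          rw [mul_left_comm, hdx2, mul_one]
      _ ≤ _ := mul_le_mul_of_nonneg_left this (by positivity)

theorem near_arith (b c : ℕ) {τ dx dz κ t Q P : ℝ} (hτ0 : 0 ≤ τ) (hdx : 0 ≤ dx) (hdz : 0 ≤ dz)
    (hκ : 0 < κ) (hxd : (b : ℝ) ^ b ≤ dx ^ 2 * τ ^ b) (hzd : (c : ℝ) ^ c ≤ dz ^ 2 * τ ^ c)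
    (h2 : τ ^ (b * c) ≤ t * κ) (hk : κ * (dx ^ c * dz ^ b) ≤ Q ^ (b * c)) (hQ2 : Q ^ 2 ≤ P) :
    ((b * c : ℕ) : ℝ) ^ (b * c) ≤ t ^ 2 * P ^ (b * c) := by
  have a1 : ((b : ℝ) ^ b) ^ c ≤ (dx ^ 2 * τ ^ b) ^ c := pow_le_pow_left₀ (by positivity) hxd _
  have a2 : ((c : ℝ) ^ c) ^ b ≤ (dz ^ 2 * τ ^ c) ^ b := pow_le_pow_left₀ (by positivity) hzd _
  have a3 : (τ ^ (b * c)) ^ 2 ≤ (t * κ) ^ 2 := pow_le_pow_left₀ (by positivity) h2 2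
  have a4 : (κ * (dx ^ c * dz ^ b)) ^ 2 ≤ (Q ^ (b * c)) ^ 2 := pow_le_pow_left₀ (by positivity) hk 2
  have a5 : (Q ^ 2) ^ (b * c) ≤ P ^ (b * c) := pow_le_pow_left₀ (by positivity) hQ2 _
  have a0 : ((b * c : ℕ) : ℝ) ^ (b * c) = ((b : ℝ) ^ b) ^ c * ((c : ℝ) ^ c) ^ b := by
    push_cast
    rw [mul_pow, ← pow_mul, ← pow_mul, mul_comm c b]
  have a6 : (dx ^ 2 * τ ^ b) ^ c * (dz ^ 2 * τ ^ c) ^ b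
      = (dx ^ c * dz ^ b) ^ 2 * (τ ^ (b * c)) ^ 2 := by
    simp only [mul_pow, ← pow_mul]
    rw [mul_comm 2 c, mul_comm 2 b, mul_comm c b, mul_comm (b * c) 2, two_mul, pow_add τ]
    ring
  rw [a0]
  calc ((b : ℝ) ^ b) ^ c * ((c : ℝ) ^ c) ^ b
      ≤ (dx ^ 2 * τ ^ b) ^ c * (dz ^ 2 * τ ^ c) ^ b :=
        mul_le_mul a1 a2 (by positivity) (by positivity)
    _ = (dx ^ c * dz ^ b) ^ 2 * (τ ^ (b * c)) ^ 2 := a6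
    _ ≤ (dx ^ c * dz ^ b) ^ 2 * (t * κ) ^ 2 := mul_le_mul_of_nonneg_left a3 (by positivity)
    _ = t ^ 2 * (κ * (dx ^ c * dz ^ b)) ^ 2 := by rw [mul_pow t, mul_pow κ]; ring
    _ ≤ t ^ 2 * (Q ^ (b * c)) ^ 2 := mul_le_mul_of_nonneg_left a4 (by positivity)
    _ = t ^ 2 * (Q ^ 2) ^ (b * c) := by rw [← pow_mul, ← pow_mul, mul_comm 2]
    _ ≤ t ^ 2 * P ^ (b * c) := mul_le_mul_of_nonneg_left a5 (by positivity)

section fin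
variable {a d : Type*} [Fintype a] [Fintype d] {b c : ℕ}

theorem rhoB_posDef (hc : 0 < c) (T : a → d → Matrix (Fin b) (Fin c) ℂ) (hT : Slope T b c) :
    (∑ i, ∑ j, T i j * (T i j)ᴴ).PosDef := by
  classical
  let F := fln T (1 : Matrix (Fin c) (Fin c) ℂ)
  have hF : F * Fᴴ = ∑ i, ∑ j, T i j * (T i j)ᴴ := by
    have e : ∀ x i j y, F x (i, j, y) = T i j x y := by
      intro x i j y
      simp only [F, fln, Matrix.of_apply, Matrix.mul_one]
    ext x y
    simp only [Matrix.mul_apply, Matrix.sum_apply, Fintype.sum_prod_type, conjTranspose_apply, e]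
  have h1 : b ≤ F.rank := by
    have := hT (Fin c) 1
    rw [Matrix.rank_one, Fintype.card_fin, mul_comm] at this
    exact Nat.le_of_mul_le_mul_left this hc
  rw [← hF]
  refine Matrix.PosDef.mul_conjTranspose_self F ?_
  rw [Matrix.vecMul_injective_iff, linearIndependent_iff_card_eq_finrank_span, Set.finrank,
    ← Matrix.rank_eq_finrank_span_row]
  refine le_antisymm (by simpa using h1) (Matrix.rank_le_card_height F)

theorem rhoC_posDef (hb : 0 < b) (T : a → d → Matrix (Fin b) (Fin c) ℂ) (hT : Slope T b c) :
    (∑ i, ∑ j, (T i j)ᴴ * T i j).PosDef := by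
  classical
  let G : Matrix (a × d × Fin b) (Fin c) ℂ := Matrix.of fun p y => T p.1 p.2.1 p.2.2 y
  have hG : Gᴴ * G = ∑ i, ∑ j, (T i j)ᴴ * T i j := by
    ext x y
    simp [G, Matrix.mul_apply, Matrix.sum_apply, Fintype.sum_prod_type]
  rw [← hG]
  refine Matrix.PosDef.conjTranspose_mul_self G ?_
  rw [← Matrix.coe_mulVecLin, ← LinearMap.ker_eq_bot, LinearMap.ker_eq_bot']
  intro v hv
  by_contra hv0
  let N : Matrix (Fin c) (Fin 1) ℂ := Matrix.of fun y _ => v y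
  have h1 : 0 < N.rank := by
    rw [Nat.pos_iff_ne_zero]
    intro h0
    apply hv0
    rw [Matrix.rank_eq_finrank_span_cols, Submodule.finrank_eq_zero,
      Submodule.span_eq_bot] at h0
    exact h0 _ ⟨0, rfl⟩
  have h2 : fln T N = 0 := by
    ext x ⟨i, j, k⟩
    have := congrFun hv (i, j, x)
    simpa [fln, N, Matrix.mul_apply, G, Matrix.mulVec, dotProduct] using this
  have h3 := hT (Fin 1) N
  rw [h2, Matrix.rank_zero, mul_zero] at h3
  have := Nat.mul_pos hb h1
  omega

theorem capq_eq_trace (T : a → d → Matrix (Fin b) (Fin c) ℂ) (g h) :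
    ((capq T g h : ℝ) : ℂ) = ∑ i, ∑ j, Matrix.trace ((g * T i j * h)ᴴ * (g * T i j * h)) := by
  simp_rw [trace_conjTranspose_mul_self', capq]
  push_cast
  rfl

theorem near_bound (hb : 0 < b) (hc : 0 < c)
    (T : a → d → Matrix (Fin b) (Fin c) ℂ) (hT : Slope T b c)
    {κ t : ℝ} (hκ : 0 < κ)
    (h1 : ∀ g h, κ * ((‖g.det‖ ^ 2) ^ c * (‖h.det‖ ^ 2) ^ b) ≤ capq T g h ^ (b * c))
    (h2 : capq T 1 1 ^ (b * c) ≤ t * κ) :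
    ((b * c : ℕ) : ℝ) ^ (b * c) ≤
      t ^ 2 * (((flR T).rank * (flK T).rank : ℕ) : ℝ) ^ (b * c) := by
  classical
  obtain ⟨x, hx, hxd⟩ := posdef_root _ (rhoB_posDef hc T hT)
  obtain ⟨z, hz, hzd⟩ := posdef_root _ (rhoC_posDef hb T hT)
  set τ := capq T 1 1 with hτ
  have hτ0 : 0 ≤ τ := by
    rw [hτ, capq]; positivity
  have htC : (Matrix.trace (∑ i, ∑ j, (T i j)ᴴ * T i j)).re = τ := by
    have := capq_eq_trace T 1 1
    simp only [Matrix.one_mul, Matrix.mul_one] at this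
    simp only [Matrix.trace_sum]
    rw [← this, Complex.ofReal_re]
  have htB : (Matrix.trace (∑ i, ∑ j, T i j * (T i j)ᴴ)).re = τ := by
    rw [← htC]
    simp only [Matrix.trace_sum]
    simp_rw [fun i j => Matrix.trace_mul_comm (T i j) (T i j)ᴴ]
  rw [htB] at hxd
  rw [htC] at hzd
  have hmx : (xᴴ * x)ᴴ = xᴴ * x := by simp
  have hmz : (zᴴ * z)ᴴ = zᴴ * z := by simp
  have hS : ∑ i, ∑ j, (T i j * (zᴴ * z))ᴴ * (T i j * (zᴴ * z)) = 1 := by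
    rw [← hz]
    simp only [conjTranspose_mul (T _ _), hmz, Matrix.mul_sum, Matrix.sum_mul, Matrix.mul_assoc]
  have hT' : ∑ i, ∑ j, ((xᴴ * x) * T i j) * ((xᴴ * x) * T i j)ᴴ = 1 := by
    rw [← hx]
    have e : ∀ i j, ((xᴴ * x) * T i j)ᴴ = (T i j)ᴴ * (xᴴ * x) := by
      intro i j
      rw [conjTranspose_mul, hmx]
    simp only [e]
    simp only [Matrix.mul_sum, Matrix.sum_mul, Matrix.mul_assoc]
  have hcs := cs_bound (fun i j => T i j * (zᴴ * z)) (fun i j => (xᴴ * x) * T i j) hS hT'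
  have hR : (flR (fun i j => T i j * (zᴴ * z))).rank ≤ (flR T).rank := by
    have := flR_filter T (1 : Matrix (Fin b) (Fin b) ℂ) (zᴴ * z)
    simpa only [Matrix.one_mul] using this
  have hK : (flK (fun i j => (xᴴ * x) * T i j)).rank ≤ (flK T).rank := by
    have := flK_filter T (xᴴ * x) (1 : Matrix (Fin c) (Fin c) ℂ)
    simpa only [Matrix.mul_one] using this
  have hQ : ∑ i, ∑ j, Matrix.trace ((T i j * (zᴴ * z))ᴴ * ((xᴴ * x) * T i j))
      = ((capq T x zᴴ : ℝ) : ℂ) := by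
    rw [capq_eq_trace]
    refine Finset.sum_congr rfl fun i _ => Finset.sum_congr rfl fun j _ => ?_
    rw [conjTranspose_mul, hmz]
    have : (x * T i j * zᴴ)ᴴ * (x * T i j * zᴴ) = (z * ((T i j)ᴴ * xᴴ * x * T i j)) * zᴴ := by
      simp only [conjTranspose_mul, conjTranspose_conjTranspose, Matrix.mul_assoc]
    rw [this, Matrix.trace_mul_comm (z * _) zᴴ]
    simp only [Matrix.mul_assoc]
  rw [hQ, Complex.norm_real, Real.norm_eq_abs, sq_abs] at hcs
  set Q := capq T x zᴴ with hQd
  have hQ2 : Q ^ 2 ≤ (((flR T).rank * (flK T).rank : ℕ) : ℝ) := by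
    refine hcs.trans ?_
    exact_mod_cast Nat.mul_le_mul hR hK
  have hk := h1 x zᴴ
  rw [Matrix.det_conjTranspose, norm_star] at hk
  exact near_arith b c hτ0 (by positivity) (by positivity) hκ hxd hzd h2 hk hQ2

theorem capq_filter (T : a → d → Matrix (Fin b) (Fin c) ℂ) (g h x y) :
    capq (fun i j => g * T i j * h) x y = capq T (x * g) (h * y) := by
  simp only [capq, Matrix.mul_assoc]

theorem semistable_bound (T : a → d → Matrix (Fin b) (Fin c) ℂ) (hT : Slope T b c) :
    b * c ≤ (flR T).rank * (flK T).rank := by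
  classical
  rcases Nat.eq_zero_or_pos b with hb | hb
  · simp [hb]
  rcases Nat.eq_zero_or_pos c with hc | hc
  · simp [hc]
  obtain ⟨κ0, hκ0, hcap⟩ := cap_pos T hT
  let Dt : Matrix (Fin b) (Fin b) ℂ → Matrix (Fin c) (Fin c) ℂ → ℝ :=
    fun g h => (‖g.det‖ ^ 2) ^ c * (‖h.det‖ ^ 2) ^ b
  have hDt0 : ∀ g h, 0 ≤ Dt g h := fun g h => by positivity
  let A : Set ℝ := {s | ∃ g h, 0 < Dt g h ∧ s = capq T g h ^ (b * c) / Dt g h}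
  have hA0 : ∀ s ∈ A, κ0 ≤ s := by
    rintro s ⟨g, h, hD, rfl⟩
    rw [le_div_iff₀ hD]
    exact hcap g h
  have hAne : A.Nonempty := ⟨_, 1, 1, by simp [Dt], rfl⟩
  have hAb : BddBelow A := ⟨κ0, hA0⟩
  set κ := sInf A with hκd
  have hκ : 0 < κ := hκ0.trans_le (le_csInf hAne hA0)
  have hcapq0 : ∀ g h, 0 ≤ capq T g h := fun g h => by unfold capq; positivity
  have hall : ∀ g h, κ * Dt g h ≤ capq T g h ^ (b * c) := by
    intro g h
    rcases (hDt0 g h).eq_or_lt with h0 | h0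
    · rw [← h0, mul_zero]; exact pow_nonneg (hcapq0 g h) _
    · rw [← le_div_iff₀ h0]
      exact csInf_le hAb ⟨g, h, h0, rfl⟩
  have main : ∀ t : ℝ, 1 < t → ((b * c : ℕ) : ℝ) ^ (b * c) ≤
      t ^ 2 * (((flR T).rank * (flK T).rank : ℕ) : ℝ) ^ (b * c) := by
    intro t ht
    obtain ⟨s, ⟨g, h, hD, rfl⟩, hs⟩ := exists_lt_of_csInf_lt hAne
      (show sInf A < t * κ from by nlinarith)
    rw [div_lt_iff₀ hD] at hs
    have hg : IsUnit g.det := by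
      rw [isUnit_iff_ne_zero]
      intro h0
      simp [Dt, h0, hc.ne'] at hD
    have hh : IsUnit h.det := by
      rw [isUnit_iff_ne_zero]
      intro h0
      simp [Dt, h0, hb.ne'] at hD
    have hsl := slope_filter T g g⁻¹ h h⁻¹ (Matrix.nonsing_inv_mul g hg)
      (Matrix.nonsing_inv_mul h hh) hT
    have := near_bound hb hc _ hsl (κ := κ * Dt g h) (t := t) (mul_pos hκ hD)
      (by
        intro x y
        rw [capq_filter]
        refine le_trans (le_of_eq ?_) (hall (x * g) (h * y))
        simp only [Dt, Matrix.det_mul, norm_mul]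
        ring)
      (by
        rw [capq_filter, Matrix.one_mul, Matrix.mul_one, ← mul_assoc]
        exact hs.le)
    refine this.trans (mul_le_mul_of_nonneg_left (pow_le_pow_left₀ (by positivity) ?_ _)
      (by positivity))
    exact_mod_cast Nat.mul_le_mul (flR_filter T g h) (flK_filter T g h)
  have lim : Filter.Tendsto (fun t : ℝ =>
      t ^ 2 * (((flR T).rank * (flK T).rank : ℕ) : ℝ) ^ (b * c)) (nhdsWithin 1 (Set.Ioi 1))
      (nhds (1 ^ 2 * (((flR T).rank * (flK T).rank : ℕ) : ℝ) ^ (b * c))) :=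
    (Continuous.tendsto (by fun_prop) 1).mono_left nhdsWithin_le_nhds
  have := ge_of_tendsto lim (by
    filter_upwards [self_mem_nhdsWithin] with t ht using main t ht)
  rw [one_pow, one_mul] at this
  have h3 := (pow_le_pow_iff_left₀ (by positivity) (by positivity)
    (Nat.mul_pos hb hc).ne').1 this
  exact_mod_cast h3

end fin
section split
variable {a d β₁ β₂ γ₁ γ₂ : Type*} [Fintype a] [Fintype d] [Fintype β₁] [Fintype β₂]
  [Fintype γ₁] [Fintype γ₂]

theorem split_R (T : a → d → Matrix (β₁ ⊕ β₂) (γ₁ ⊕ γ₂) ℂ)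
    (h0 : ∀ i j x y, T i j (Sum.inr x) (Sum.inl y) = 0) :
    (flR (fun i j => (T i j).submatrix Sum.inl Sum.inl)).rank +
      (flR (fun i j => (T i j).submatrix Sum.inr Sum.inr)).rank ≤ (flR T).rank := by
  have := rank_triangular ((flR T).submatrix (Equiv.prodSumDistrib a β₁ β₂).symm
    (Equiv.sumProdDistrib γ₁ γ₂ d).symm) (by
      rintro ⟨i, x⟩ ⟨y, j⟩
      simp [flR, h0])
  rw [Matrix.rank_submatrix] at this
  exact this

theorem split_K (T : a → d → Matrix (β₁ ⊕ β₂) (γ₁ ⊕ γ₂) ℂ)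
    (h0 : ∀ i j x y, T i j (Sum.inr x) (Sum.inl y) = 0) :
    (flK (fun i j => (T i j).submatrix Sum.inl Sum.inl)).rank +
      (flK (fun i j => (T i j).submatrix Sum.inr Sum.inr)).rank ≤ (flK T).rank := by
  have := rank_triangular ((flK T).submatrix
    ((Equiv.sumComm _ _).trans (Equiv.prodSumDistrib a γ₁ γ₂).symm)
    ((Equiv.sumComm _ _).trans (Equiv.sumProdDistrib β₁ β₂ d).symm)) (by
      rintro ⟨i, x⟩ ⟨y, j⟩
      simp [flK, h0])
  rw [Matrix.rank_submatrix, add_comm] at this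
  exact this

theorem split_r (T : a → d → Matrix (β₁ ⊕ β₂) (γ₁ ⊕ γ₂) ℂ)
    (h0 : ∀ i j x y, T i j (Sum.inr x) (Sum.inl y) = 0) :
    (flr T).rank ≤ Fintype.card β₁ * (Fintype.card γ₁ + Fintype.card γ₂) +
      (flr (fun i j => (T i j).submatrix Sum.inr Sum.inr)).rank := by
  have h1 := rank_cols_le ((flr T).submatrix id (Equiv.sumProdDistrib β₁ β₂ (γ₁ ⊕ γ₂)).symm)
  have e1 := Matrix.rank_submatrix (flr T) (Equiv.refl _)
    (Equiv.sumProdDistrib β₁ β₂ (γ₁ ⊕ γ₂)).symm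
  rw [Equiv.coe_refl] at e1
  rw [e1] at h1
  set A := ((flr T).submatrix id (Equiv.sumProdDistrib β₁ β₂ (γ₁ ⊕ γ₂)).symm) with hA
  have h2 : (A.submatrix id Sum.inl).rank ≤
      Fintype.card β₁ * (Fintype.card γ₁ + Fintype.card γ₂) := by
    refine (Matrix.rank_le_card_width _).trans ?_
    simp
  have h3 := rank_cols_le ((A.submatrix id Sum.inr).submatrix id
    (Equiv.prodSumDistrib β₂ γ₁ γ₂).symm)
  have e2 := Matrix.rank_submatrix (A.submatrix id Sum.inr) (Equiv.refl _)
    (Equiv.prodSumDistrib β₂ γ₁ γ₂).symm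
  rw [Equiv.coe_refl] at e2
  rw [e2] at h3
  have h4 : ((A.submatrix id Sum.inr).submatrix id
    (Equiv.prodSumDistrib β₂ γ₁ γ₂).symm).submatrix id Sum.inl = 0 := by
    ext ⟨i, j⟩ ⟨x, y⟩
    simp [hA, flr, h0]
  rw [h4, Matrix.rank_zero, zero_add] at h3
  have h5 : ((A.submatrix id Sum.inr).submatrix id
    (Equiv.prodSumDistrib β₂ γ₁ γ₂).symm).submatrix id Sum.inr
      = flr (fun i j => (T i j).submatrix Sum.inr Sum.inr) := by
    ext ⟨i, j⟩ ⟨x, y⟩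
    simp [hA, flr]
  rw [h5] at h3
  omega

theorem slope_left [DecidableEq γ₁] (T : a → d → Matrix (β₁ ⊕ β₂) (γ₁ ⊕ γ₂) ℂ)
    (h0 : ∀ i j x y, T i j (Sum.inr x) (Sum.inl y) = 0) {p q : ℕ} (hT : Slope T p q) :
    Slope (fun i j => (T i j).submatrix Sum.inl Sum.inl) p q := by
  intro e _ N
  have h := hT e (Matrix.fromRows N 0)
  have h1 : N.rank ≤ (Matrix.fromRows N (0 : Matrix γ₂ e ℂ)).rank := by
    have := Matrix.rank_submatrix_le (Matrix.fromRows N (0 : Matrix γ₂ e ℂ)) Sum.inl id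
    exact this
  have h2 := rank_rows_le (fln T (Matrix.fromRows N 0))
  have h3 : (fln T (Matrix.fromRows N 0)).submatrix Sum.inl id
      = fln (fun i j => (T i j).submatrix Sum.inl Sum.inl) N := by
    ext x ⟨i, j, y⟩
    simp [fln, Matrix.mul_apply]
  have h4 : (fln T (Matrix.fromRows N 0)).submatrix Sum.inr id = 0 := by
    ext x ⟨i, j, y⟩
    simp [fln, Matrix.mul_apply, h0]
  rw [h3, h4, Matrix.rank_zero, add_zero] at h2
  exact (Nat.mul_le_mul_left _ h1).trans (h.trans (Nat.mul_le_mul_left _ h2))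

theorem slope_right {b c : ℕ} (T : a → d → Matrix (Fin b ⊕ β₂) (Fin c ⊕ γ₂) ℂ)
    (h0 : ∀ i j x y, T i j (Sum.inr x) (Sum.inl y) = 0) (hT : Slope T b c) :
    Slope (fun i j => (T i j).submatrix Sum.inr Sum.inr) b c := by
  classical
  intro e _ N
  have h := hT (Fin c ⊕ e) (Matrix.fromBlocks 1 0 0 N)
  have h1 := rank_triangular (Matrix.fromBlocks (1 : Matrix (Fin c) (Fin c) ℂ) 0 0 N)
    (by simp)
  have e1 : (Matrix.fromBlocks (1 : Matrix (Fin c) (Fin c) ℂ) 0 0 N).submatrix Sum.inl Sum.inl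
      = 1 := by ext; simp
  have e2 : (Matrix.fromBlocks (1 : Matrix (Fin c) (Fin c) ℂ) 0 0 N).submatrix Sum.inr Sum.inr
      = N := by ext; simp
  rw [e1, e2, Matrix.rank_one, Fintype.card_fin] at h1
  have h2 := rank_rows_le (fln T (Matrix.fromBlocks (1 : Matrix (Fin c) (Fin c) ℂ) 0 0 N))
  have h3 : ((fln T (Matrix.fromBlocks (1 : Matrix (Fin c) (Fin c) ℂ) 0 0 N)).submatrix
      Sum.inl id).rank ≤ b := by
    simpa using Matrix.rank_le_card_height ((fln T (Matrix.fromBlocks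
      (1 : Matrix (Fin c) (Fin c) ℂ) 0 0 N)).submatrix Sum.inl id)
  have h4 : (fln T (Matrix.fromBlocks (1 : Matrix (Fin c) (Fin c) ℂ) 0 0 N)).submatrix
      Sum.inr id = fln (fun i j => (T i j).submatrix Sum.inr Sum.inr)
        (N * Matrix.fromCols (0 : Matrix e (Fin c) ℂ) (1 : Matrix e e ℂ)) := by
    ext x ⟨i, j, y | y⟩
    · simp [fln, Matrix.mul_apply, h0, Matrix.mul_fromCols]
    · simp [fln, Matrix.mul_apply, h0, Matrix.mul_fromCols]
  have h5 := fln_right (fun i j => (T i j).submatrix Sum.inr Sum.inr) N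
    (Matrix.fromCols (0 : Matrix e (Fin c) ℂ) (1 : Matrix e e ℂ))
  rw [← h4] at h5
  have h6 := (Nat.mul_le_mul_left b h1).trans (h.trans
    (Nat.mul_le_mul_left c (h2.trans (Nat.add_le_add h3 h5))))
  rw [mul_add, mul_add, mul_comm b c] at h6
  exact Nat.le_of_add_le_add_left h6

end split

section induct
variable {a d : Type*} [Fintype a] [Fintype d]

theorem exists_min_slope {b c : ℕ} (hc : 0 < c) (T : a → d → Matrix (Fin b) (Fin c) ℂ) :
    ∃ (N : Matrix (Fin c) (Fin c) ℂ), 0 < N.rank ∧ Slope T (fln T N).rank N.rank := by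
  classical
  have key : ∃ v : ℕ, ∃ N : Matrix (Fin c) (Fin c) ℂ, 0 < N.rank ∧
      v = (fln T N).rank * (c.factorial / N.rank) :=
    ⟨_, 1, by simpa using hc, rfl⟩
  obtain ⟨N, hN, hv⟩ := Nat.find_spec key
  refine ⟨N, hN, ?_⟩
  intro e _ N'
  rcases Nat.eq_zero_or_pos N'.rank with h | h
  · simp [h]
  have hsq : ∃ N'' : Matrix (Fin c) (Fin c) ℂ, N''.rank = N'.rank ∧
      (fln T N'').rank ≤ (fln T N').rank := by
    obtain ⟨s', hs, g, g', W, h1, h2, h3, h4⟩ := exists_adapted N'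
    refine ⟨N' * (W * Matrix.fromCols (1 : Matrix (Fin N'.rank) (Fin N'.rank) ℂ)
        (0 : Matrix (Fin N'.rank) (Fin s') ℂ) * g), ?_,
      fln_right _ _ _⟩
    rw [← Matrix.mul_assoc, ← Matrix.mul_assoc, ← h4]
    let D : Matrix (Fin N'.rank ⊕ Fin s') (Fin N'.rank ⊕ Fin s') ℂ := Matrix.fromBlocks 1 0 0 0
    have e : g'.submatrix id Sum.inl * Matrix.fromCols (1 : Matrix (Fin N'.rank) (Fin N'.rank) ℂ)
        (0 : Matrix (Fin N'.rank) (Fin s') ℂ) = g' * D := by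
      ext i (j | j) <;> simp [D, Matrix.mul_apply, Matrix.one_apply]
    rw [e]
    apply le_antisymm
    · refine (Matrix.rank_mul_le_left _ _).trans ((Matrix.rank_mul_le_right _ _).trans ?_)
      refine (rank_rows_le _).trans ?_
      have : D.submatrix Sum.inr id = 0 := by
        ext i (j | j) <;> simp [D]
      rw [this, Matrix.rank_zero, add_zero]
      simpa using Matrix.rank_le_card_height (D.submatrix Sum.inl id)
    · have hx := (Matrix.rank_mul_le_left (g * (g' * D * g)) g')
      have hy := Matrix.rank_mul_le_right g (g' * D * g)
      have hz : g * (g' * D * g) * g' = D := by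
        simp only [← Matrix.mul_assoc, h1, Matrix.one_mul]
        rw [Matrix.mul_assoc, h1, Matrix.mul_one]
      rw [hz] at hx
      have hw := Matrix.rank_submatrix_le D Sum.inl Sum.inl
      have e1 : D.submatrix Sum.inl Sum.inl = 1 := by ext; simp [D]
      rw [e1, Matrix.rank_one, Fintype.card_fin] at hw
      omega
  obtain ⟨N'', hr, hn⟩ := hsq
  have hmin : Nat.find key ≤ (fln T N'').rank * (c.factorial / N''.rank) :=
    Nat.find_min' key ⟨N'', by omega, rfl⟩
  rw [hv] at hmin
  have hd : ∀ M : Matrix (Fin c) (Fin c) ℂ, 0 < M.rank →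
      c.factorial / M.rank * M.rank = c.factorial := fun M hM =>
    Nat.div_mul_cancel (Nat.dvd_factorial hM (by simpa using M.rank_le_card_width))
  have d1 := hd N hN
  have d2 := hd N'' (by omega)
  have hf := Nat.factorial_pos c
  have : c.factorial * ((fln T N).rank * N''.rank) ≤ c.factorial * (N.rank * (fln T N'').rank) := by
    calc c.factorial * ((fln T N).rank * N''.rank)
        = ((fln T N).rank * (c.factorial / N.rank)) * (N.rank * N''.rank) := by
          rw [← d1]; simp only [Nat.mul_div_cancel _ hN]; ring
      _ ≤ ((fln T N'').rank * (c.factorial / N''.rank)) * (N.rank * N''.rank) :=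
          Nat.mul_le_mul_right _ hmin
      _ = (c.factorial / N''.rank * N''.rank) * (N.rank * (fln T N'').rank) := by ring
      _ = _ := by rw [d2]
  have := Nat.le_of_mul_le_mul_left this hf
  rw [hr] at this
  exact this.trans (Nat.mul_le_mul_left _ hn)

theorem arith_step {R K R1 K1 R' K' b1 c1 c' r r' : ℕ} (hc1 : 0 < c1)
    (hR : R1 + R' ≤ R) (hK : K1 + K' ≤ K) (h1 : b1 * c1 ≤ R1 * K1)
    (h2 : r' ≤ R' * K') (h3 : b1 * c' ^ 2 ≤ c1 * (R' * K')) (hr : r ≤ b1 * (c1 + c') + r') :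
    r ≤ R * K ∧ b1 * (c1 + c') ^ 2 ≤ c1 * (R * K) := by
  have hRK : (R1 + R') * (K1 + K') ≤ R * K := Nat.mul_le_mul hR hK
  have hx : 2 * (b1 * c') ≤ R1 * K' + R' * K1 := by
    have h4 : (b1 * c') ^ 2 ≤ (R1 * K') * (R' * K1) := by
      have : c1 * (b1 * c') ^ 2 ≤ c1 * ((R1 * K') * (R' * K1)) := by
        calc c1 * (b1 * c') ^ 2 = (b1 * c1) * (b1 * c' ^ 2) := by ring
          _ ≤ (R1 * K1) * (c1 * (R' * K')) := Nat.mul_le_mul h1 h3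
          _ = _ := by ring
      exact Nat.le_of_mul_le_mul_left this hc1
    zify at h4 ⊢
    set x : ℤ := R1 * K'
    set y : ℤ := R' * K1
    have hx : 0 ≤ x := by positivity
    have hy : 0 ≤ y := by positivity
    refine abs_le_of_sq_le_sq' (a := 2 * ((b1 : ℤ) * c')) ?_ (by positivity) |>.2
    nlinarith [sq_nonneg (x - y)]
  have hexp : R1 * K1 + R' * K' + (R1 * K' + R' * K1) ≤ R * K := by
    refine le_trans (le_of_eq ?_) hRK; ring
  constructor
  · nlinarith
  · have : c1 * (R1 * K1 + R' * K' + (R1 * K' + R' * K1)) ≤ c1 * (R * K) :=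
      Nat.mul_le_mul_left _ hexp
    have h5 : c1 * (b1 * c1) ≤ c1 * (R1 * K1) := Nat.mul_le_mul_left _ h1
    have h6 : c1 * (2 * (b1 * c')) ≤ c1 * (R1 * K' + R' * K1) := Nat.mul_le_mul_left _ hx
    nlinarith

theorem key_induct : ∀ (c b : ℕ) (T : a → d → Matrix (Fin b) (Fin c) ℂ),
    (flr T).rank ≤ (flR T).rank * (flK T).rank ∧
    ∀ p q, Slope T p q → p * c ^ 2 ≤ q * ((flR T).rank * (flK T).rank) := by
  classical
  intro c
  induction c using Nat.strong_induction_on with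
  | _ c ih =>
  intro b T
  rcases Nat.eq_zero_or_pos c with rfl | hc
  · refine ⟨?_, by simp⟩
    have := Matrix.rank_le_card_width (flr T)
    simp at this
    simp [this]
  obtain ⟨N, hN, hS⟩ := exists_min_slope hc T
  obtain ⟨c', hcc, h', h, W, hh1, hh2, hh3, hh4⟩ := exists_adapted N
  obtain ⟨b', hbb, g, g', W', hg1, hg2, hg3, hg4⟩ := exists_adapted (fln T N)
  rw [Fintype.card_fin] at hcc hbb
  set T2 : a → d → Matrix (Fin (fln T N).rank ⊕ Fin b') (Fin N.rank ⊕ Fin c') ℂ :=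
    fun i j => g * T i j * h with hT2
  have h0 : ∀ i j x y, T2 i j (Sum.inr x) (Sum.inl y) = 0 := by
    intro i j x y
    have e1 : T2 i j (Sum.inr x) (Sum.inl y) =
        (g * T i j * (h.submatrix id Sum.inl)) (Sum.inr x) y := by
      simp [hT2, Matrix.mul_apply]
    rw [e1, hh4, ← Matrix.mul_assoc, Matrix.mul_apply]
    refine Finset.sum_eq_zero fun l _ => ?_
    have : (g * T i j * N) (Sum.inr x) l = (g * fln T N) (Sum.inr x) (i, j, l) := by
      rw [Matrix.mul_assoc, Matrix.mul_apply, Matrix.mul_apply]; rfl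
    rw [this, hg3, zero_mul]
  have hS2 : Slope T2 (fln T N).rank N.rank := slope_filter T g g' h h' hg2 hh1 hS
  have hR := (split_R T2 h0).trans (flR_filter T g h)
  have hK := (split_K T2 h0).trans (flK_filter T g h)
  have hr := split_r T2 h0
  have hr' : (flr T).rank ≤ (flr T2).rank := by
    have := flr_filter T2 g' h'
    have e : (fun i j => g' * T2 i j * h') = T := by
      funext i j
      simp only [hT2]
      calc g' * (g * T i j * h) * h' = (g' * g) * T i j * (h * h') := by
            simp only [Matrix.mul_assoc]
        _ = T i j := by rw [hg2, hh2, Matrix.one_mul, Matrix.mul_one]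
    rwa [e] at this
  simp only [Fintype.card_fin] at hr
  have hY := semistable_bound _ (slope_left T2 h0 hS2)
  obtain ⟨i1, i2⟩ := ih c' (by omega) b' (fun i j => (T2 i j).submatrix Sum.inr Sum.inr)
  have i3 := i2 _ _ (slope_right T2 h0 hS2)
  have fin := arith_step hN hR hK hY i1 i3 (hr'.trans hr)
  rw [hcc] at fin
  refine ⟨fin.1, fun p q hpq => ?_⟩
  have h9 := hpq _ N
  have : N.rank * (p * c ^ 2) ≤ N.rank * (q * ((flR T).rank * (flK T).rank)) := by
    calc N.rank * (p * c ^ 2) = (p * N.rank) * c ^ 2 := by ring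
      _ ≤ (q * (fln T N).rank) * c ^ 2 := Nat.mul_le_mul_right _ h9
      _ = q * ((fln T N).rank * c ^ 2) := by ring
      _ ≤ q * (N.rank * ((flR T).rank * (flK T).rank)) := Nat.mul_le_mul_left _ fin.2
      _ = _ := by ring
  exact Nat.le_of_mul_le_mul_left this hN

theorem key {b c : Type*} [Fintype b] [Fintype c] (T : a → d → Matrix b c ℂ) :
    (flr T).rank ≤ (flR T).rank * (flK T).rank := by
  let eb := Fintype.equivFin b
  let ec := Fintype.equivFin c
  let T' : a → d → Matrix (Fin (Fintype.card b)) (Fin (Fintype.card c)) ℂ :=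
    fun i j => (T i j).submatrix eb.symm ec.symm
  have := (key_induct _ _ T').1
  have e1 : (flR T').rank = (flR T).rank :=
    Matrix.rank_submatrix (flR T) ((Equiv.refl a).prodCongr eb.symm)
      (ec.symm.prodCongr (Equiv.refl d))
  have e2 : (flK T').rank = (flK T).rank :=
    Matrix.rank_submatrix (flK T) ((Equiv.refl a).prodCongr ec.symm)
      (eb.symm.prodCongr (Equiv.refl d))
  have e3 : (flr T').rank = (flr T).rank :=
    Matrix.rank_submatrix (flr T) (Equiv.refl _) (eb.symm.prodCongr ec.symm)
  rwa [e1, e2, e3] at this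

end induct
section
variable {a₁ a₂ a₃ a₄ a₅ : Type*}
  [Fintype a₁] [Fintype a₂] [Fintype a₃] [Fintype a₄] [Fintype a₅]

theorem rank_le_of_transpose_sub {m n m' n' : Type*} [Fintype m] [Fintype n] [Fintype m']
    [Fintype n'] (A : Matrix m n ℂ) (B : Matrix m' n' ℂ) (f : m → n') (g : n → m')
    (h : ∀ i j, A i j = B (g j) (f i)) : A.rank ≤ B.rank := by
  have : A = Bᵀ.submatrix f g := by ext i j; simp [h]
  rw [this, ← Matrix.rank_transpose B]
  exact Matrix.rank_submatrix_le _ _ _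

/-- For any five-partite positive semidefinite matrix,
`r(ρ_{A₁A₂A₃A₄}) · r(ρ_{A₁A₂A₃A₅}) · r(ρ_{A₁A₂A₄A₅}) · r(ρ_{A₁A₃A₄A₅}) ≥
r(ρ_{A₂A₃A₄A₅})`. -/
theorem rank_four_party_reductions_ge
    [DecidableEq a₁] [DecidableEq a₂] [DecidableEq a₃] [DecidableEq a₄] [DecidableEq a₅]
    (ρ : Matrix (a₁ × a₂ × a₃ × a₄ × a₅) (a₁ × a₂ × a₃ × a₄ × a₅) ℂ)
    (hρ : ρ.PosSemidef) :
    (tr5 ρ).rank * (tr4 ρ).rank * (tr3 ρ).rank * (tr2 ρ).rank ≥ (tr1 ρ).rank := by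
  obtain ⟨B, hB⟩ : ∃ B : Matrix (a₁ × a₂ × a₃ × a₄ × a₅) (a₁ × a₂ × a₃ × a₄ × a₅) ℂ,
      ρ = Bᴴ * B := by
    open scoped MatrixOrder in
    have := (CStarAlgebra.nonneg_iff_eq_star_mul_self).1 hρ.nonneg
    simpa [Matrix.star_eq_conjTranspose] using this
  let L := Bᴴ
  have hL : ρ = L * Lᴴ := by simp [L, hB]
  let E := a₁ × a₂ × a₃ × a₄ × a₅
  let M5 : Matrix (a₁ × a₂ × a₃ × a₄) (a₅ × E) ℂ :=
    Matrix.of fun p k => L (p.1, p.2.1, p.2.2.1, p.2.2.2, k.1) k.2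
  let M4 : Matrix (a₁ × a₂ × a₃ × a₅) (a₄ × E) ℂ :=
    Matrix.of fun p k => L (p.1, p.2.1, p.2.2.1, k.1, p.2.2.2) k.2
  let M3 : Matrix (a₁ × a₂ × a₄ × a₅) (a₃ × E) ℂ :=
    Matrix.of fun p k => L (p.1, p.2.1, k.1, p.2.2.1, p.2.2.2) k.2
  let M2 : Matrix (a₁ × a₃ × a₄ × a₅) (a₂ × E) ℂ :=
    Matrix.of fun p k => L (p.1, k.1, p.2.1, p.2.2.1, p.2.2.2) k.2
  let M1 : Matrix (a₂ × a₃ × a₄ × a₅) (a₁ × E) ℂ :=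
    Matrix.of fun p k => L (k.1, p.1, p.2.1, p.2.2.1, p.2.2.2) k.2
  have e5 : tr5 ρ = M5 * M5ᴴ := by
    ext p q
    simp only [tr5, hL, Matrix.mul_apply, Matrix.of_apply, M5, Matrix.conjTranspose_apply]
    rw [Fintype.sum_prod_type]
  have e4 : tr4 ρ = M4 * M4ᴴ := by
    ext p q
    simp only [tr4, hL, Matrix.mul_apply, Matrix.of_apply, M4, Matrix.conjTranspose_apply]
    rw [Fintype.sum_prod_type]
  have e3 : tr3 ρ = M3 * M3ᴴ := by
    ext p q
    simp only [tr3, hL, Matrix.mul_apply, Matrix.of_apply, M3, Matrix.conjTranspose_apply]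
    rw [Fintype.sum_prod_type]
  have e2 : tr2 ρ = M2 * M2ᴴ := by
    ext p q
    simp only [tr2, hL, Matrix.mul_apply, Matrix.of_apply, M2, Matrix.conjTranspose_apply]
    rw [Fintype.sum_prod_type]
  have e1 : tr1 ρ = M1 * M1ᴴ := by
    ext p q
    simp only [tr1, hL, Matrix.mul_apply, Matrix.of_apply, M1, Matrix.conjTranspose_apply]
    rw [Fintype.sum_prod_type]
  rw [e5, e4, e3, e2, e1]
  simp only [Matrix.rank_self_mul_conjTranspose]
  let T1 : E → a₁ → Matrix a₂ (a₃ × a₄ × a₅) ℂ :=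
    fun x i => Matrix.of fun j k => L (i, j, k.1, k.2.1, k.2.2) x
  let T2 : Unit → (a₁ × a₂) → Matrix (a₃ × E) (a₄ × a₅) ℂ :=
    fun _ i => Matrix.of fun j k => L (i.1, i.2, j.1, k.1, k.2) j.2
  let T3 : E → (a₁ × a₂ × a₃) → Matrix a₄ a₅ ℂ :=
    fun x i => Matrix.of fun j k => L (i.1, i.2.1, i.2.2, j, k) x
  have k1 := key T1
  have k2 := key T2
  have k3 := key T3
  have s1 : M1.rank ≤ (flr T1).rank := rank_le_of_transpose_sub _ _
    (fun i => (i.1, i.2)) (fun j => (j.2, j.1)) (fun _ _ => rfl)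
  have s2 : (flR T1).rank ≤ M2.rank := rank_le_of_transpose_sub _ _
    (fun i => (i.2, i.1)) (fun j => (j.2, j.1)) (fun _ _ => rfl)
  have s3 : (flK T1).rank ≤ (flr T2).rank := rank_le_of_transpose_sub _ _
    (fun i => ((i.2.1, i.1), i.2.2)) (fun j => ((), (j.2, j.1))) (fun _ _ => rfl)
  have s4 : (flR T2).rank ≤ M3.rank := rank_le_of_transpose_sub _ _
    (fun i => i.2) (fun j => (j.2.1, j.2.2, j.1)) (fun _ _ => rfl)
  have s5 : (flK T2).rank ≤ (flr T3).rank := rank_le_of_transpose_sub _ _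
    (fun i => i.2) (fun j => (j.1.2, (j.2.1, j.2.2, j.1.1))) (fun _ _ => rfl)
  have s6 : (flR T3).rank ≤ M4.rank := rank_le_of_transpose_sub _ _
    (fun i => (i.2, i.1)) (fun j => (j.2.1, j.2.2.1, j.2.2.2, j.1)) (fun _ _ => rfl)
  have s7 : (flK T3).rank ≤ M5.rank := rank_le_of_transpose_sub _ _
    (fun i => (i.2, i.1)) (fun j => (j.2.1, j.2.2.1, j.2.2.2, j.1)) (fun _ _ => rfl)
  calc M1.rank ≤ (flR T1).rank * (flK T1).rank := s1.trans k1
    _ ≤ M2.rank * ((flR T2).rank * (flK T2).rank) := Nat.mul_le_mul s2 (s3.trans k2)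
    _ ≤ M2.rank * (M3.rank * ((flR T3).rank * (flK T3).rank)) :=
        Nat.mul_le_mul_left _ (Nat.mul_le_mul s4 (s5.trans k3))
    _ ≤ M2.rank * (M3.rank * (M4.rank * M5.rank)) :=
        Nat.mul_le_mul_left _ (Nat.mul_le_mul_left _ (Nat.mul_le_mul s6 s7))
    _ = M5.rank * M4.rank * M3.rank * M2.rank := by ring

end
end
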